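/- arXiv:2303.10496 — 3 statements merged into one kernel-verified Lean document; each statement's English description precedes it below -/
import Mathlib

section
/- Fix an integer N ≥ 1. There is a constant C depending only on N with the following property. Let A > 0 and α, β, γ ∈ (0,1], and let K : ℤ³ → ℂ satisfy |K_{n₁,n₂,n₃}| ≤ A·α·β·γ·(1+α|n₁|)^{−10}·(1+β|n₂|)^{−10}·(1+γ|n₃|)^{−10−N} for all n₁, n₂, n₃ ∈ ℤ. Let R ≥ 0 and let f, g, h : ℤ → ℂ be sequences such that |m − m'| ≥ R for every m in the support of f and every m' in the support of h. Define T(f,g,h)_m = ∑_{k₁,k₂,k₃ ∈ ℤ} f_{k₁ − m} g_{k₂ + k₁ − m} h_{k₃ + k₁ − m} K_{k₁,k₂,k₃}. Then for all exponents 1 ≤ p₁, p₂, p₃, p ≤ ∞ with 1/p₁ + 1/p₂ + 1/p₃ = 1/p, ‖T(f,g,h)‖_{ℓ^p} ≤ C · A · (1 + γR)^{−N} · ‖f‖_{ℓ^{p₁}} ‖g‖_{ℓ^{p₂}} ‖h‖_{ℓ^{p₃}}. -/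
open MeasureTheory
open scoped ENNReal

/-- The trilinear pseudoproduct with kernel `K`. -/
noncomputable def pseudoProd (K : ℤ × ℤ × ℤ → ℂ) (f g h : ℤ → ℂ) (m : ℤ) : ℂ :=
  ∑' k : ℤ × ℤ × ℤ, f (k.1 - m) * g (k.2.1 + k.1 - m) * h (k.2.2 + k.1 - m) * K k

/-- Minkowski's inequality for infinite sums on `ℤ` with counting measure. -/
theorem eLpNorm_count_tsum_le {ι : Type*} (u : ι → ℤ → ℝ≥0∞) (p : ℝ≥0∞) (hp : 1 ≤ p) :
    eLpNorm (fun m => ∑' i, u i m) p (Measure.count : Measure ℤ) ≤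
      ∑' i, eLpNorm (u i) p (Measure.count : Measure ℤ) := by
  have hp0 : p ≠ 0 := fun h => by simp [h] at hp
  rcases eq_or_ne p ∞ with rfl | hpt
  · simp only [eLpNorm_exponent_top]
    refine eLpNormEssSup_le_of_ae_enorm_bound (Filter.Eventually.of_forall fun m => ?_)
    rw [enorm_eq_self]
    refine ENNReal.tsum_le_tsum fun i => ?_
    have := ae_le_eLpNormEssSup (f := u i) (μ := (Measure.count : Measure ℤ))
    rw [Measure.ae_count_iff] at this
    simpa using this m
  · have hpr : 0 < p.toReal := ENNReal.toReal_pos hp0 hpt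
    set B := ∑' i, eLpNorm (u i) p (Measure.count : Measure ℤ) with hB
    rw [eLpNorm_eq_lintegral_rpow_enorm_toReal hp0 hpt, lintegral_count, one_div,
      ENNReal.rpow_inv_le_iff hpr]
    simp only [enorm_eq_self]
    refine ENNReal.summable.tsum_le_of_sum_le fun M => ?_
    have hlim : Filter.Tendsto (fun s : Finset ι => ∑ m ∈ M, (∑ i ∈ s, u i m) ^ p.toReal)
        Filter.atTop (nhds (∑ m ∈ M, (∑' i, u i m) ^ p.toReal)) := by
      refine tendsto_finsetSum _ fun m _ => ?_
      exact ((ENNReal.continuous_rpow_const).tendsto _).comp ENNReal.summable.hasSum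
    refine le_of_tendsto' hlim fun s => ?_
    have h1 : eLpNorm (∑ i ∈ s, u i) p (Measure.count : Measure ℤ) ≤ B :=
      (eLpNorm_sum_le (fun i _ => (measurable_of_countable _).aestronglyMeasurable) hp).trans
        (ENNReal.sum_le_tsum s)
    rw [eLpNorm_eq_lintegral_rpow_enorm_toReal hp0 hpt, lintegral_count, one_div,
      ENNReal.rpow_inv_le_iff hpr] at h1
    refine le_trans ?_ h1
    simpa using ENNReal.sum_le_tsum (f := fun m => (∑ i ∈ s, u i m) ^ p.toReal) M

/-- The weights have uniformly bounded sum. -/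
theorem tsum_weight_le (α : ℝ) (h0 : 0 < α) (h1 : α ≤ 1) :
    ∑' n : ℤ, ENNReal.ofReal (α / (1 + α * |(n : ℝ)|) ^ 10) ≤ 3 := by
  have key : ∀ n : ℕ, α / (1 + α * ((n : ℝ) + 1)) ^ 10 ≤
      1 / (1 + α * n) - 1 / (1 + α * ((n + 1 : ℕ) : ℝ)) := by
    intro n
    have hn : (0 : ℝ) ≤ α * n := by positivity
    have e : 1 / (1 + α * (n : ℝ)) - 1 / (1 + α * ((n + 1 : ℕ) : ℝ)) =
        α / ((1 + α * n) * (1 + α * ((n : ℝ) + 1))) := by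
      have : 1 + α * ((n : ℝ) + 1) ≠ 0 := by positivity
      have : 1 + α * (n : ℝ) ≠ 0 := by positivity
      push_cast
      field_simp
      ring
    rw [e]
    apply div_le_div_of_nonneg_left h0.le (by positivity)
    calc (1 + α * (n : ℝ)) * (1 + α * ((n : ℝ) + 1))
        ≤ (1 + α * ((n : ℝ) + 1)) * (1 + α * ((n : ℝ) + 1)) := by
          gcongr; linarith
      _ = (1 + α * ((n : ℝ) + 1)) ^ 2 := by ring
      _ ≤ _ := pow_le_pow_right₀ (by nlinarith) (by norm_num)
  have half : ∑' n : ℕ, ENNReal.ofReal (α / (1 + α * ((n : ℝ) + 1)) ^ 10) ≤ 1 := by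
    refine ENNReal.tsum_le_of_sum_range_le fun n => ?_
    rw [← ENNReal.ofReal_sum_of_nonneg (fun i _ => by positivity)]
    rw [← ENNReal.ofReal_one]
    apply ENNReal.ofReal_le_ofReal
    refine (Finset.sum_le_sum fun i _ => key i).trans ?_
    rw [Finset.sum_range_sub' (fun i : ℕ => 1 / (1 + α * (i : ℝ)))]
    have : 0 ≤ 1 / (1 + α * (n : ℝ)) := by positivity
    simp at this ⊢
    exact this
  rw [tsum_of_nat_of_neg_add_one ENNReal.summable ENNReal.summable,
    tsum_eq_zero_add' ENNReal.summable]
  have e1 : ∀ n : ℕ, |(((n + 1 : ℕ) : ℤ) : ℝ)| = (n : ℝ) + 1 := fun n => by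
    push_cast; exact abs_of_nonneg (by positivity)
  have e2 : ∀ n : ℕ, |((-((n : ℤ) + 1) : ℤ) : ℝ)| = (n : ℝ) + 1 := fun n => by
    push_cast; rw [abs_neg]; exact abs_of_nonneg (by positivity)
  simp only [e1, e2]
  have h3 : (3 : ℝ≥0∞) = 1 + 1 + 1 := by norm_num
  rw [h3]
  refine add_le_add (add_le_add ?_ half) half
  simpa using h1

theorem eLpNorm_count_comp (f : ℤ → ℂ) (p : ℝ≥0∞) (a : ℤ) :
    eLpNorm (fun m => f (a - m)) p (Measure.count : Measure ℤ) = eLpNorm f p Measure.count :=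
  eLpNorm_comp_measurePreserving (measurable_of_countable f).aestronglyMeasurable
    (Measure.measurePreserving_sub_left (Measure.count : Measure ℤ) a)

theorem eLpNorm_triple (f g h : ℤ → ℂ) (p₁ p₂ p₃ p : ℝ≥0∞)
    (hp : 1 / p₁ + 1 / p₂ + 1 / p₃ = 1 / p) :
    eLpNorm (fun m => f m * g m * h m) p (Measure.count : Measure ℤ) ≤
      eLpNorm f p₁ Measure.count * eLpNorm g p₂ Measure.count * eLpNorm h p₃ Measure.count := by
  simp only [one_div] at hp
  have ms : ∀ f : ℤ → ℂ, AEStronglyMeasurable f (Measure.count : Measure ℤ) :=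
    fun f => (measurable_of_countable f).aestronglyMeasurable
  have : ENNReal.HolderTriple p₁ p₂ (p₁⁻¹ + p₂⁻¹)⁻¹ := ⟨by rw [inv_inv]⟩
  have : ENNReal.HolderTriple (p₁⁻¹ + p₂⁻¹)⁻¹ p₃ p := ⟨by rw [inv_inv, hp]⟩
  have a := eLpNorm_smul_le_mul_eLpNorm (p := (p₁⁻¹ + p₂⁻¹)⁻¹) (q := p₃) (r := p)
    (ms h) (ms (f • g))
  have b := eLpNorm_smul_le_mul_eLpNorm (p := p₁) (q := p₂) (r := (p₁⁻¹ + p₂⁻¹)⁻¹)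
    (ms g) (ms f)
  exact a.trans (mul_le_mul_left b _)

/-- Pseudolocality of pseudoproducts: if the kernel decays at scale `γ⁻¹` in the
third variable and the supports of `f` and `h` are separated by `R`, the
pseudoproduct gains a factor `(1 + γR)^(-N)`. -/
theorem pseudoProd_pseudolocal (N : ℕ) (hN : 1 ≤ N) :
    ∃ C : ℝ, 0 < C ∧
      ∀ (A α β γ : ℝ), 0 < A → α ∈ Set.Ioc (0 : ℝ) 1 → β ∈ Set.Ioc (0 : ℝ) 1 →
        γ ∈ Set.Ioc (0 : ℝ) 1 →
      ∀ K : ℤ × ℤ × ℤ → ℂ,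
        (∀ n₁ n₂ n₃ : ℤ, ‖K (n₁, n₂, n₃)‖ ≤
          A * α * β * γ / ((1 + α * |(n₁ : ℝ)|) ^ 10 * (1 + β * |(n₂ : ℝ)|) ^ 10 *
            (1 + γ * |(n₃ : ℝ)|) ^ (10 + N))) →
      ∀ R : ℝ, 0 ≤ R →
      ∀ f g h : ℤ → ℂ,
        (∀ m ∈ Function.support f, ∀ m' ∈ Function.support h, R ≤ |((m - m' : ℤ) : ℝ)|) →
      ∀ p₁ p₂ p₃ p : ℝ≥0∞, 1 ≤ p₁ → 1 ≤ p₂ → 1 ≤ p₃ → 1 ≤ p →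
        1 / p₁ + 1 / p₂ + 1 / p₃ = 1 / p →
        eLpNorm (pseudoProd K f g h) p Measure.count ≤
          ENNReal.ofReal (C * A / (1 + γ * R) ^ N) *
            (eLpNorm f p₁ Measure.count * eLpNorm g p₂ Measure.count *
              eLpNorm h p₃ Measure.count) := by
  refine ⟨27, by norm_num, ?_⟩
  intro A α β γ hA hα hβ hγ K hK R hR f g h hsupp p₁ p₂ p₃ p _ _ _ hp hpp
  obtain ⟨hα0, hα1⟩ := hα
  obtain ⟨hβ0, hβ1⟩ := hβ
  obtain ⟨hγ0, hγ1⟩ := hγ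
  set c : ℝ := A / (1 + γ * R) ^ N with hc
  have hc0 : 0 ≤ c := by positivity
  let w : ℝ → ℤ → ℝ≥0∞ := fun a n => ENNReal.ofReal (a / (1 + a * |(n : ℝ)|) ^ 10)
  let W : ℤ × ℤ × ℤ → ℝ≥0∞ := fun k =>
    ENNReal.ofReal c * (w α k.1 * (w β k.2.1 * w γ k.2.2))
  let F : ℤ × ℤ × ℤ → ℤ → ℂ := fun k m =>
    f (k.1 - m) * g (k.2.1 + k.1 - m) * h (k.2.2 + k.1 - m)
  have hWtop : ∀ k, W k ≠ ∞ := fun k => by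
    simp only [W, w]
    finiteness
  -- pointwise bound
  have hterm : ∀ k m, ‖F k m * K k‖ₑ ≤ W k * ‖F k m‖ₑ := by
    rintro ⟨n₁, n₂, n₃⟩ m
    by_cases hF : F (n₁, n₂, n₃) m = 0
    · simp [hF]
    have hf : f (n₁ - m) ≠ 0 := fun h0 => hF (by simp [F, h0])
    have hh : h (n₃ + n₁ - m) ≠ 0 := fun h0 => hF (by simp [F, h0])
    have hRn : R ≤ |(n₃ : ℝ)| := by
      have := hsupp _ hf _ hh
      rw [show n₁ - m - (n₃ + n₁ - m) = -n₃ by ring] at this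
      simpa using this
    rw [enorm_mul, mul_comm]
    refine mul_le_mul_left ?_ _
    have hb : ‖K (n₁, n₂, n₃)‖ ≤ c * (α / (1 + α * |(n₁ : ℝ)|) ^ 10 *
        (β / (1 + β * |(n₂ : ℝ)|) ^ 10 * (γ / (1 + γ * |(n₃ : ℝ)|) ^ 10))) := by
      refine (hK n₁ n₂ n₃).trans ?_
      have e : c * (α / (1 + α * |(n₁ : ℝ)|) ^ 10 *
        (β / (1 + β * |(n₂ : ℝ)|) ^ 10 * (γ / (1 + γ * |(n₃ : ℝ)|) ^ 10))) =
        A * α * β * γ / ((1 + α * |(n₁ : ℝ)|) ^ 10 * (1 + β * |(n₂ : ℝ)|) ^ 10 *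
          ((1 + γ * |(n₃ : ℝ)|) ^ 10 * (1 + γ * R) ^ N)) := by
        rw [hc]; field_simp
      rw [e, pow_add]
      gcongr
    rw [← ofReal_norm]
    refine (ENNReal.ofReal_le_ofReal hb).trans ?_
    simp only [W, w]
    rw [ENNReal.ofReal_mul hc0, ENNReal.ofReal_mul (by positivity),
      ENNReal.ofReal_mul (by positivity)]
  have hpt : ∀ m, ‖pseudoProd K f g h m‖ₑ ≤ ‖∑' k, W k * ‖F k m‖ₑ‖ₑ := fun m => by
    rw [enorm_eq_self]
    exact enorm_tsum_le_tsum_enorm.trans (ENNReal.tsum_le_tsum fun k => hterm k m)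
  refine (eLpNorm_mono_enorm hpt).trans ?_
  refine (eLpNorm_count_tsum_le _ p hp).trans ?_
  set P := eLpNorm f p₁ Measure.count * eLpNorm g p₂ Measure.count *
              eLpNorm h p₃ Measure.count with hP
  have hk : ∀ k, eLpNorm (fun m => W k * ‖F k m‖ₑ) p Measure.count ≤ W k * P := by
    intro k
    have e : eLpNorm (fun m => W k * ‖F k m‖ₑ) p Measure.count =
        eLpNorm (fun m => ((W k).toReal : ℂ) * F k m) p Measure.count := by
      refine eLpNorm_congr_enorm_ae (Filter.Eventually.of_forall fun m => ?_)
      simp only [enorm_eq_self, enorm_mul]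
      congr 1
      rw [← ofReal_norm]
      simp [ENNReal.ofReal_toReal (hWtop k)]
    have e2 : eLpNorm (fun m => ((W k).toReal : ℂ) * F k m) p Measure.count =
        W k * eLpNorm (F k) p Measure.count := by
      have := eLpNorm_const_smul ((W k).toReal : ℂ) (F k) p (Measure.count : Measure ℤ)
      rw [← ofReal_norm] at this
      simp only [Complex.norm_real, Real.norm_eq_abs, ENNReal.abs_toReal,
        ENNReal.ofReal_toReal (hWtop k)] at this
      exact this
    rw [e, e2]
    refine mul_le_mul_right ?_ _
    refine (eLpNorm_triple _ _ _ p₁ p₂ p₃ p hpp).trans ?_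
    rw [eLpNorm_count_comp, eLpNorm_count_comp, eLpNorm_count_comp]
  refine (ENNReal.tsum_le_tsum hk).trans ?_
  rw [ENNReal.tsum_mul_right]
  refine mul_le_mul_left ?_ _
  have hsum : ∑' k, W k = ENNReal.ofReal c * ((∑' n, w α n) * ((∑' n, w β n) * ∑' n, w γ n)) := by
    simp only [W, ENNReal.tsum_prod', ENNReal.tsum_mul_left, ENNReal.tsum_mul_right]
  rw [hsum]
  have hC : ENNReal.ofReal (27 * A / (1 + γ * R) ^ N) = ENNReal.ofReal c * (3 * (3 * 3)) := by
    rw [show 27 * A / (1 + γ * R) ^ N = c * 27 by rw [hc]; ring, ENNReal.ofReal_mul hc0]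
    norm_num
  rw [hC]
  gcongr
  · exact tsum_weight_le α hα0 hα1
  · exact tsum_weight_le β hβ0 hβ1
  · exact tsum_weight_le γ hγ0 hγ1
end

section
/- There exists a constant C > 0 with the following property. Let t ≥ 1, A > 0, and let f : ℤ → ℂ be a sequence such that its Fourier transform f̂(ξ) = (2π)^{-1/2} ∑_{n∈ℤ} f_n e^{inξ} satisfies |f̂(ξ)| ≤ A for all ξ, and such that (∑_{n∈ℤ} n²|f_n|²)^{1/2} ≤ A·t^{1/6}. Define u_n(t) = (2π)^{-1/2} ∫_{−π}^{π} e^{2it cos ξ} f̂(ξ) e^{−inξ} dξ. Then |u_n(t)| ≤ C · A · t^{−1/3} for all n ∈ ℤ. -/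
/-- The Fourier transform of a sequence `f : ℤ → ℂ`:
`f̂(ξ) = (2π)^{-1/2} ∑_{n∈ℤ} f_n e^{inξ}`. -/
noncomputable def discFT (f : ℤ → ℂ) (ξ : ℝ) : ℂ :=
  (Real.sqrt (2 * Real.pi) : ℂ)⁻¹ *
    ∑' n : ℤ, f n * Complex.exp (Complex.I * (n : ℂ) * (ξ : ℂ))

/-- The linear Ablowitz–Ladik propagator applied to `f` at time `t`:
`u_n(t) = (2π)^{-1/2} ∫_{−π}^{π} e^{2it cos ξ} f̂(ξ) e^{−inξ} dξ`. -/
noncomputable def alProp (f : ℤ → ℂ) (t : ℝ) (n : ℤ) : ℂ :=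
  (Real.sqrt (2 * Real.pi) : ℂ)⁻¹ *
    ∫ ξ in (-Real.pi)..Real.pi,
      Complex.exp (((2 * t * Real.cos ξ : ℝ) : ℂ) * Complex.I) * discFT f ξ *
        Complex.exp (-(Complex.I * (n : ℂ) * (ξ : ℂ)))


open MeasureTheory Set

lemma al_ofReal_sin_sq (M b : ℝ) (hM : 0 < M) :
    ∫ x in (-Real.pi)..Real.pi, (1 + 4 * M ^ 2 * Real.sin ((x - b) / 2) ^ 2)⁻¹
      ≤ Real.pi ^ 2 / (2 * M) := by
  have hpi := Real.pi_pos
  set F : ℝ → ℝ := fun x => (1 + 4 * M ^ 2 * Real.sin (x / 2) ^ 2)⁻¹ with hF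
  have hper : Function.Periodic F (2 * Real.pi) := by
    intro x
    have : (x + 2 * Real.pi) / 2 = x / 2 + Real.pi := by ring
    simp only [hF, this, Real.sin_add_pi, neg_sq]
  have hcont : Continuous F := by
    refine Continuous.inv₀ (by fun_prop) (fun x => ?_)
    positivity
  have h1 : ∫ x in (-Real.pi)..Real.pi, F (x - b) = ∫ x in (-Real.pi)..Real.pi, F x := by
    rw [intervalIntegral.integral_comp_sub_right]
    have := hper.intervalIntegral_add_eq (-Real.pi - b) (-Real.pi)
    rw [show -Real.pi - b + 2 * Real.pi = Real.pi - b by ring,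
      show -Real.pi + 2 * Real.pi = Real.pi by ring] at this
    exact this
  change ∫ x in (-Real.pi)..Real.pi, F (x - b) ≤ _
  rw [h1]
  set c : ℝ := 2 * M / Real.pi with hc
  have hc0 : 0 < c := by positivity
  have h2 : ∫ x in (-Real.pi)..Real.pi, F x ≤
      ∫ x in (-Real.pi)..Real.pi, (1 + (c * x) ^ 2)⁻¹ := by
    apply intervalIntegral.integral_mono_on (by linarith) (hcont.intervalIntegrable _ _)
    · apply Continuous.intervalIntegrable
      refine Continuous.inv₀ (by fun_prop) (fun x => ?_)
      positivity
    · intro x hx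
      apply inv_anti₀ (by positivity)
      have hx' : |x / 2| ≤ Real.pi / 2 := by
        rw [abs_le]; constructor <;> linarith [hx.1, hx.2]
      have h3 := Real.mul_abs_le_abs_sin hx'
      have h4 : (2 / Real.pi * |x / 2|) ^ 2 ≤ |Real.sin (x / 2)| ^ 2 := by
        gcongr
      rw [mul_pow, sq_abs, sq_abs] at h4
      have h5 : (c * x) ^ 2 = 4 * M ^ 2 * ((2 / Real.pi) ^ 2 * (x / 2) ^ 2) := by
        rw [hc]; field_simp
        try ring
      rw [h5]
      gcongr
  have h3 : ∫ x in (-Real.pi)..Real.pi, (1 + (c * x) ^ 2)⁻¹ =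
      c⁻¹ * (Real.arctan (c * Real.pi) - Real.arctan (c * (-Real.pi))) := by
    rw [intervalIntegral.integral_comp_mul_left (fun x => (1 + x ^ 2)⁻¹) hc0.ne']
    rw [integral_inv_one_add_sq, smul_eq_mul]
  rw [h3] at h2
  refine h2.trans ?_
  have h6 := Real.arctan_lt_pi_div_two (c * Real.pi)
  have h7 := Real.neg_pi_div_two_lt_arctan (c * (-Real.pi))
  calc _ ≤ c⁻¹ * Real.pi := by gcongr; linarith
    _ = _ := by rw [hc]; field_simp

lemma al_pointwise (P Q : ℝ) (hP : 0 ≤ P) (hQ : 0 ≤ Q) :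
    (1 + P * Q)⁻¹ ≤ (1 + P)⁻¹ + (1 + Q)⁻¹ := by
  have : 0 ≤ P * Q := by positivity
  rw [inv_add_inv (by positivity) (by positivity), inv_le_iff_one_le_mul₀ (by positivity),
    div_mul_eq_mul_div, one_le_div (by positivity)]
  nlinarith [mul_nonneg this hP, mul_nonneg this hQ]

/-- distance from `sin x` to `a` dominates distance to a point of `[-1,1]`. -/
lemma al_clip (a : ℝ) : ∃ α : ℝ, ∀ x : ℝ, (Real.sin x - Real.sin α) ^ 2 ≤ (Real.sin x - a) ^ 2 := by
  rcases le_total a (-1) with h | h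
  · refine ⟨-(Real.pi / 2), fun x => ?_⟩
    rw [Real.sin_neg, Real.sin_pi_div_two]
    have := Real.neg_one_le_sin x
    nlinarith
  rcases le_total a 1 with h' | h'
  · exact ⟨Real.arcsin a, fun x => by rw [Real.sin_arcsin h h']⟩
  · refine ⟨Real.pi / 2, fun x => ?_⟩
    rw [Real.sin_pi_div_two]
    have := Real.sin_le_one x
    nlinarith

lemma al_J (M ν : ℝ) (hM : 0 < M) :
    ∫ x in (-Real.pi)..Real.pi, ((2 * M ^ 3 * Real.sin x + ν) ^ 2 + M ^ 2)⁻¹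
      ≤ Real.pi ^ 2 / M ^ 3 := by
  have hpi := Real.pi_pos
  obtain ⟨α, hα⟩ := al_clip (-(ν / (2 * M ^ 3)))
  have hcont : ∀ b : ℝ, Continuous
      (fun x : ℝ => (1 + 4 * M ^ 2 * Real.sin ((x - b) / 2) ^ 2)⁻¹) := by
    intro b
    refine Continuous.inv₀ (by fun_prop) (fun x => ?_)
    positivity
  set β : ℝ := -α - Real.pi with hβ
  have key : ∀ x : ℝ, ((2 * M ^ 3 * Real.sin x + ν) ^ 2 + M ^ 2)⁻¹ ≤
      (M ^ 2)⁻¹ * ((1 + 4 * M ^ 2 * Real.sin ((x - α) / 2) ^ 2)⁻¹ +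
        (1 + 4 * M ^ 2 * Real.sin ((x - β) / 2) ^ 2)⁻¹) := by
    intro x
    have h1 : Real.sin ((x - β) / 2) = Real.cos ((x + α) / 2) := by
      rw [← Real.sin_add_pi_div_two]; congr 1; rw [hβ]; ring
    have h2 := Real.sin_sub_sin x α
    have h3 := hα x
    rw [h2] at h3
    have h4 : (2 * M ^ 3 * Real.sin x + ν) ^ 2 =
        4 * M ^ 6 * (Real.sin x - -(ν / (2 * M ^ 3))) ^ 2 := by
      field_simp
      try ring
    have h5 := al_pointwise (4 * M ^ 2 * Real.sin ((x - α) / 2) ^ 2)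
      (4 * M ^ 2 * Real.sin ((x - β) / 2) ^ 2) (by positivity) (by positivity)
    refine le_trans ?_ (mul_le_mul_of_nonneg_left h5 (by positivity))
    rw [← mul_inv]
    apply inv_anti₀ (by positivity)
    rw [h4, h1]
    have h6 := mul_le_mul_of_nonneg_left h3 (show 0 ≤ 4 * M ^ 6 by positivity)
    nlinarith
  calc _ ≤ ∫ x in (-Real.pi)..Real.pi,
      (M ^ 2)⁻¹ * ((1 + 4 * M ^ 2 * Real.sin ((x - α) / 2) ^ 2)⁻¹ +
        (1 + 4 * M ^ 2 * Real.sin ((x - β) / 2) ^ 2)⁻¹) := by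
        apply intervalIntegral.integral_mono_on (by linarith)
        · apply Continuous.intervalIntegrable
          refine Continuous.inv₀ (by fun_prop) (fun x => ?_)
          positivity
        · exact (((hcont α).add (hcont β)).const_mul _).intervalIntegrable _ _
        · intro x _; exact key x
    _ = (M ^ 2)⁻¹ * ((∫ x in (-Real.pi)..Real.pi,
          (1 + 4 * M ^ 2 * Real.sin ((x - α) / 2) ^ 2)⁻¹) +
        ∫ x in (-Real.pi)..Real.pi, (1 + 4 * M ^ 2 * Real.sin ((x - β) / 2) ^ 2)⁻¹) := by
        rw [intervalIntegral.integral_const_mul, intervalIntegral.integral_add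
          ((hcont α).intervalIntegrable _ _) ((hcont β).intervalIntegrable _ _)]
    _ ≤ (M ^ 2)⁻¹ * (Real.pi ^ 2 / (2 * M) + Real.pi ^ 2 / (2 * M)) := by
        gcongr <;> exact al_ofReal_sin_sq M _ hM
    _ = _ := by field_simp; try ring

/-- variation on a piece where the derivative has a sign -/
lemma al_piece (q q' : ℝ → ℝ) (M a b : ℝ) (hM : 0 < M) (hab : a ≤ b)
    (hq : ∀ x, HasDerivAt q (q' x) x) (hq' : Continuous q')
    (hs : (∀ x ∈ Icc a b, 0 ≤ q' x) ∨ (∀ x ∈ Icc a b, q' x ≤ 0)) :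
    ∫ x in a..b, |q' x| * (q x ^ 2 + M ^ 2)⁻¹ ≤ Real.pi / M := by
  have hqc : Continuous q := continuous_iff_continuousAt.2 fun x => (hq x).continuousAt
  have hd : ∀ x ∈ uIcc a b, HasDerivAt (fun y => Real.arctan (q y / M) / M)
      (q' x * (q x ^ 2 + M ^ 2)⁻¹) x := by
    intro x _
    have := (((hq x).div_const M).arctan).div_const M
    refine this.congr_deriv ?_
    field_simp
    try ring
  have hc : Continuous (fun x => q' x * (q x ^ 2 + M ^ 2)⁻¹) := by
    refine hq'.mul (Continuous.inv₀ (by fun_prop) (fun x => ?_))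
    positivity
  have hi := intervalIntegral.integral_eq_sub_of_hasDerivAt hd (hc.intervalIntegrable _ _)
  have e1 := Real.arctan_lt_pi_div_two (q a / M)
  have e2 := Real.neg_pi_div_two_lt_arctan (q a / M)
  have e3 := Real.arctan_lt_pi_div_two (q b / M)
  have e4 := Real.neg_pi_div_two_lt_arctan (q b / M)
  rcases hs with h | h
  · have : ∫ x in a..b, |q' x| * (q x ^ 2 + M ^ 2)⁻¹ =
        ∫ x in a..b, q' x * (q x ^ 2 + M ^ 2)⁻¹ := by
      apply intervalIntegral.integral_congr
      intro x hx
      rw [uIcc_of_le hab] at hx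
      simp only [abs_of_nonneg (h x hx)]
    rw [this, hi, ← sub_div]
    gcongr
    linarith
  · have : ∫ x in a..b, |q' x| * (q x ^ 2 + M ^ 2)⁻¹ =
        ∫ x in a..b, -(q' x * (q x ^ 2 + M ^ 2)⁻¹) := by
      apply intervalIntegral.integral_congr
      intro x hx
      rw [uIcc_of_le hab] at hx
      simp only [abs_of_nonpos (h x hx), neg_mul]
    rw [this, intervalIntegral.integral_neg, hi, ← sub_div, ← neg_div]
    gcongr
    linarith

lemma al_var (M ν t : ℝ) (hM : 0 < M) (ht : 0 ≤ t) :
    ∫ x in (-Real.pi)..Real.pi, |2 * t * Real.cos x| * ((2 * t * Real.sin x + ν) ^ 2 + M ^ 2)⁻¹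
      ≤ 3 * Real.pi / M := by
  have hpi := Real.pi_pos
  have hq : ∀ x, HasDerivAt (fun x => 2 * t * Real.sin x + ν) (2 * t * Real.cos x) x := fun x =>
    ((Real.hasDerivAt_sin x).const_mul _).add_const _
  have hq' : Continuous (fun x => 2 * t * Real.cos x) := by fun_prop
  have hc : Continuous (fun x =>
      |2 * t * Real.cos x| * ((2 * t * Real.sin x + ν) ^ 2 + M ^ 2)⁻¹) := by
    refine Continuous.mul (by fun_prop) (Continuous.inv₀ (by fun_prop) (fun x => ?_))
    positivity
  have p1 := al_piece _ _ M (-Real.pi) (-(Real.pi / 2)) hM (by linarith) hq hq' (Or.inr (by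
    intro x hx
    refine mul_nonpos_of_nonneg_of_nonpos (by linarith) ?_
    rw [← Real.cos_neg]
    exact Real.cos_nonpos_of_pi_div_two_le_of_le (by linarith [hx.2]) (by linarith [hx.1])))
  have p2 := al_piece _ _ M (-(Real.pi / 2)) (Real.pi / 2) hM (by linarith) hq hq' (Or.inl (by
    intro x hx
    exact mul_nonneg (by linarith) (Real.cos_nonneg_of_mem_Icc hx)))
  have p3 := al_piece _ _ M (Real.pi / 2) Real.pi hM (by linarith) hq hq' (Or.inr (by
    intro x hx
    refine mul_nonpos_of_nonneg_of_nonpos (by linarith) ?_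
    exact Real.cos_nonpos_of_pi_div_two_le_of_le (by linarith [hx.1]) (by linarith [hx.2])))
  rw [← intervalIntegral.integral_add_adjacent_intervals (b := -(Real.pi / 2))
      (hc.intervalIntegrable _ _) (hc.intervalIntegrable _ _),
    ← intervalIntegral.integral_add_adjacent_intervals (a := -(Real.pi / 2)) (b := Real.pi / 2)
      (hc.intervalIntegrable _ _) (hc.intervalIntegrable _ _)]
  have : 3 * Real.pi / M = Real.pi / M + (Real.pi / M + Real.pi / M) := by ring
  rw [this]
  exact add_le_add p1 (add_le_add p2 p3)


lemma al_parseval (W : ℝ → ℂ) (hW : Continuous W) :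
    HasSum (fun k : ℤ => ‖∫ x in (-Real.pi)..Real.pi,
        W x * Complex.exp (Complex.I * (k : ℂ) * (x : ℂ))‖ ^ 2)
      (2 * Real.pi * ∫ x in (-Real.pi)..Real.pi, ‖W x‖ ^ 2) := by
  have hpi := Real.pi_pos
  have hab : -Real.pi < Real.pi := by linarith
  have hmem : MemLp W 2 (volume.restrict (Ioc (-Real.pi) Real.pi)) := by
    obtain ⟨K, hK⟩ := isCompact_Icc.exists_bound_of_continuousOn
      (s := Icc (-Real.pi) Real.pi) hW.continuousOn
    refine MemLp.of_bound hW.aestronglyMeasurable K ?_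
    refine (ae_restrict_iff' measurableSet_Ioc).2 ?_
    filter_upwards with x hx using hK x (Ioc_subset_Icc_self hx)
  have h := hasSum_sq_fourierCoeffOn hab hmem
  rw [← (Equiv.neg ℤ).hasSum_iff] at h
  have h2 := h.mul_left ((2 * Real.pi) ^ 2)
  have e0 : (2 * Real.pi) ^ 2 * (Real.pi - -Real.pi)⁻¹ •
      ∫ x in (-Real.pi)..Real.pi, ‖W x‖ ^ 2 =
      2 * Real.pi * ∫ x in (-Real.pi)..Real.pi, ‖W x‖ ^ 2 := by
    rw [smul_eq_mul]; field_simp; ring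
  rw [e0] at h2
  have e3 : (fun k : ℤ => ‖∫ x in (-Real.pi)..Real.pi,
        W x * Complex.exp (Complex.I * (k : ℂ) * (x : ℂ))‖ ^ 2) = (fun i =>
        (2 * Real.pi) ^ 2 * ((fun i => ‖fourierCoeffOn hab W i‖ ^ 2) ∘ (Equiv.neg ℤ)) i) := by
    funext k
    simp only [Function.comp, Equiv.neg_apply]
    rw [fourierCoeffOn_eq_integral, neg_neg, norm_smul, mul_pow ‖_‖, ← mul_assoc]
    have e1 : (2 * Real.pi) ^ 2 * ‖(1 / (Real.pi - -Real.pi))‖ ^ 2 = 1 := by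
      rw [Real.norm_eq_abs, sq_abs]; field_simp; ring
    rw [e1, one_mul]
    congr 2
    apply intervalIntegral.integral_congr
    intro x _
    simp only [smul_eq_mul]
    rw [fourier_coe_apply, mul_comm]
    congr 2
    have : (Real.pi : ℂ) ≠ 0 := by exact_mod_cast hpi.ne'
    push_cast
    field_simp
    ring
  rw [e3]
  exact h2

lemma al_summable (f : ℤ → ℂ) (hs : Summable (fun n : ℤ => (n : ℝ) ^ 2 * ‖f n‖ ^ 2)) :
    Summable (fun n : ℤ => ‖f n‖) := by
  have h1 : Summable (fun n : ℤ => 1 / (n : ℝ) ^ 2) :=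
    Real.summable_one_div_int_pow.2 (by norm_num)
  have h2 : Summable (fun n : ℤ => if n = 0 then ‖f 0‖ else 0) :=
    (hasSum_ite_eq (0 : ℤ) (‖f 0‖)).summable
  refine Summable.of_nonneg_of_le (fun n => norm_nonneg _) (fun n => ?_) ((h1.add hs).add h2)
  by_cases hn : n = 0
  · subst hn; simp
  · have : (n : ℝ) ≠ 0 := by exact_mod_cast hn
    simp only [hn, if_false, add_zero]
    have h3 : 1 / (n : ℝ) ^ 2 = (1 / (n : ℝ)) ^ 2 := by ring
    have h4 : (1 / |(n : ℝ)|) ^ 2 = 1 / (n : ℝ) ^ 2 := by rw [div_pow, sq_abs]; norm_num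
    have h5 : 1 / |(n : ℝ)| * (|(n : ℝ)| * ‖f n‖) = ‖f n‖ := by
      have := abs_pos.2 this
      field_simp
    have h6 : (|(n : ℝ)| * ‖f n‖) ^ 2 = (n : ℝ) ^ 2 * ‖f n‖ ^ 2 := by rw [mul_pow, sq_abs]
    rw [← h4, ← h6]
    nlinarith [sq_nonneg (1 / |(n : ℝ)| - (|(n : ℝ)| * ‖f n‖)), norm_nonneg (f n)]

lemma al_norm_exp (k : ℤ) (x : ℝ) : ‖Complex.exp (Complex.I * (k : ℂ) * (x : ℂ))‖ = 1 := by
  have : Complex.I * (k : ℂ) * (x : ℂ) = ((k * x : ℝ) : ℂ) * Complex.I := by push_cast; ring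
  rw [this, Complex.norm_exp_ofReal_mul_I]

lemma al_cont (f : ℤ → ℂ) (hs : Summable (fun n : ℤ => ‖f n‖)) : Continuous (discFT f) := by
  unfold discFT
  refine continuous_const.mul (continuous_tsum (fun n => by fun_prop) hs (fun n x => ?_))
  rw [norm_mul, al_norm_exp, mul_one]

lemma al_hasSum (f : ℤ → ℂ) (hs : Summable (fun n : ℤ => ‖f n‖)) (w : ℝ → ℂ) (hw : Continuous w) :
    HasSum (fun k : ℤ => f k * ∫ x in (-Real.pi)..Real.pi,
        w x * Complex.exp (Complex.I * (k : ℂ) * (x : ℂ)))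
      ((Real.sqrt (2 * Real.pi) : ℂ) * ∫ x in (-Real.pi)..Real.pi, w x * discFT f x) := by
  have hpi := Real.pi_pos
  have hsq : (Real.sqrt (2 * Real.pi) : ℂ) ≠ 0 := by
    have : Real.sqrt (2 * Real.pi) ≠ 0 := by positivity
    exact_mod_cast this
  have h := intervalIntegral.hasSum_integral_of_dominated_convergence (a := -Real.pi) (b := Real.pi)
    (μ := volume) (ι := ℤ)
    (F := fun k x => w x * (f k * Complex.exp (Complex.I * (k : ℂ) * (x : ℂ))))
    (f := fun x => w x * ∑' k : ℤ, f k * Complex.exp (Complex.I * (k : ℂ) * (x : ℂ)))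
    (fun k x => ‖w x‖ * ‖f k‖)
    (fun k => by
      apply Continuous.aestronglyMeasurable
      fun_prop)
    (fun k => by
      filter_upwards with x _
      rw [norm_mul, norm_mul, al_norm_exp, mul_one])
    (by filter_upwards with x _ using hs.mul_left _)
    (by
      simp_rw [tsum_mul_left]
      apply Continuous.intervalIntegrable
      fun_prop)
    (by
      filter_upwards with x _
      refine HasSum.mul_left _ (Summable.hasSum ?_)
      refine Summable.of_norm ?_
      simpa only [norm_mul, al_norm_exp, mul_one] using hs)
  have e1 : (fun k : ℤ => f k * ∫ x in (-Real.pi)..Real.pi,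
        w x * Complex.exp (Complex.I * (k : ℂ) * (x : ℂ))) = (fun k : ℤ =>
        ∫ x in (-Real.pi)..Real.pi, w x * (f k * Complex.exp (Complex.I * (k : ℂ) * (x : ℂ)))) := by
    funext k
    rw [← intervalIntegral.integral_const_mul]
    congr 1; funext x; ring
  have e2 : ((Real.sqrt (2 * Real.pi) : ℂ) * ∫ x in (-Real.pi)..Real.pi, w x * discFT f x) =
      ∫ x in (-Real.pi)..Real.pi,
        w x * ∑' k : ℤ, f k * Complex.exp (Complex.I * (k : ℂ) * (x : ℂ)) := by
    rw [← intervalIntegral.integral_const_mul]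
    congr 1; funext x
    rw [discFT, mul_left_comm, mul_inv_cancel_left₀ hsq]
  rw [e1, e2]
  exact h

lemma al_ibp (W W' : ℝ → ℂ) (hW : ∀ x, HasDerivAt W (W' x) x) (hW' : Continuous W')
    (hper : W Real.pi = W (-Real.pi)) (k : ℤ) :
    ‖∫ x in (-Real.pi)..Real.pi, W' x * Complex.exp (Complex.I * (k : ℂ) * (x : ℂ))‖ =
    |(k : ℝ)| * ‖∫ x in (-Real.pi)..Real.pi, W x * Complex.exp (Complex.I * (k : ℂ) * (x : ℂ))‖ := by
  have he : ∀ x : ℝ, HasDerivAt (fun x : ℝ => Complex.exp (Complex.I * (k : ℂ) * (x : ℂ)))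
      (Complex.I * k * Complex.exp (Complex.I * (k : ℂ) * (x : ℂ))) x := by
    intro x
    have h1 : HasDerivAt (fun x : ℝ => Complex.I * (k : ℂ) * (x : ℂ)) (Complex.I * k) x := by
      simpa using (Complex.ofRealCLM.hasDerivAt (x := x)).const_mul (Complex.I * (k : ℂ))
    have := h1.cexp
    exact this.congr_deriv (mul_comm _ _)
  have h := intervalIntegral.integral_deriv_mul_eq_sub (a := -Real.pi) (b := Real.pi)
    (u := W) (u' := W') (fun x _ => hW x) (fun x _ => he x)
    (hW'.intervalIntegrable _ _) ((by fun_prop : Continuous _).intervalIntegrable _ _)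
  have hWc : Continuous W := continuous_iff_continuousAt.2 fun x => (hW x).continuousAt
  rw [intervalIntegral.integral_add ((by fun_prop : Continuous _).intervalIntegrable _ _)
    ((by fun_prop : Continuous _).intervalIntegrable _ _)] at h
  have hexp : Complex.exp (Complex.I * (k : ℂ) * (Real.pi : ℂ)) =
      Complex.exp (Complex.I * (k : ℂ) * ((-Real.pi : ℝ) : ℂ)) := by
    rw [Complex.exp_eq_exp_iff_exists_int]
    exact ⟨k, by push_cast; ring⟩
  rw [hexp, hper, sub_self] at h
  have h2 : ∫ x in (-Real.pi)..Real.pi, W x * (Complex.I * k *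
      Complex.exp (Complex.I * (k : ℂ) * (x : ℂ))) =
      (Complex.I * k) * ∫ x in (-Real.pi)..Real.pi, W x *
      Complex.exp (Complex.I * (k : ℂ) * (x : ℂ)) := by
    rw [← intervalIntegral.integral_const_mul]
    congr 1; funext x; ring
  rw [h2] at h
  rw [eq_neg_of_add_eq_zero_left h, norm_neg, norm_mul, norm_mul, Complex.norm_I, one_mul,
    Complex.norm_intCast]

lemma al_pair (f : ℤ → ℂ) (hs : Summable (fun n : ℤ => (n : ℝ) ^ 2 * ‖f n‖ ^ 2))
    (W W' : ℝ → ℂ) (hW : ∀ x, HasDerivAt W (W' x) x) (hW' : Continuous W')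
    (hper : W Real.pi = W (-Real.pi)) :
    ‖∫ x in (-Real.pi)..Real.pi, W' x * discFT f x‖ ≤
      Real.sqrt (∑' n : ℤ, (n : ℝ) ^ 2 * ‖f n‖ ^ 2) *
        Real.sqrt (∫ x in (-Real.pi)..Real.pi, ‖W x‖ ^ 2) := by
  have hpi := Real.pi_pos
  have hWc : Continuous W := continuous_iff_continuousAt.2 fun x => (hW x).continuousAt
  have h1 := al_hasSum f (al_summable f hs) W' hW'
  have hP := al_parseval W hWc
  set c : ℤ → ℝ := fun k => ‖∫ x in (-Real.pi)..Real.pi,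
        W x * Complex.exp (Complex.I * (k : ℂ) * (x : ℂ))‖ with hc
  set g : ℤ → ℝ := fun k => |(k : ℝ)| * ‖f k‖ with hg
  have hg2 : ∀ k, (g k) ^ (2 : ℝ) = (k : ℝ) ^ 2 * ‖f k‖ ^ 2 := by
    intro k; rw [hg]; simp only [Real.rpow_two, mul_pow, sq_abs]
  have hCS := Real.summable_and_inner_le_Lp_mul_Lq_tsum_of_nonneg Real.HolderConjugate.two_two
    (f := g) (g := c) (fun k => by positivity) (fun k => norm_nonneg _)
    (by simpa only [hg2] using hs) (by simpa only [Real.rpow_two] using hP.summable)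
  simp only [hg2, Real.rpow_two] at hCS
  rw [hP.tsum_eq, ← Real.sqrt_eq_rpow, ← Real.sqrt_eq_rpow, Real.sqrt_mul (by positivity)] at hCS
  have hnorm : ∀ k : ℤ, ‖f k * ∫ x in (-Real.pi)..Real.pi,
        W' x * Complex.exp (Complex.I * (k : ℂ) * (x : ℂ))‖ = g k * c k := by
    intro k
    rw [norm_mul, al_ibp W W' hW hW' hper k]
    simp only [hg, hc]; ring
  have h3 := norm_tsum_le_tsum_norm (f := fun k : ℤ => f k * ∫ x in (-Real.pi)..Real.pi,
        W' x * Complex.exp (Complex.I * (k : ℂ) * (x : ℂ))) (by simpa only [hnorm] using hCS.1)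
  simp only [hnorm] at h3
  rw [h1.tsum_eq, norm_mul, Complex.norm_real, Real.norm_of_nonneg (Real.sqrt_nonneg _)] at h3
  have h4 := h3.trans hCS.2
  have hp : 0 < Real.sqrt (2 * Real.pi) := by positivity
  refine le_of_mul_le_mul_left ?_ hp
  linarith

lemma al_phase (M ν t A : ℝ) (n : ℤ) (hν : ν = n) (hM : 0 < M) (ht : t = M ^ 3) (hA : 0 < A)
    (f : ℤ → ℂ) (hf : ∀ ξ : ℝ, ‖discFT f ξ‖ ≤ A)
    (hs : Summable (fun n : ℤ => (n : ℝ) ^ 2 * ‖f n‖ ^ 2))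
    (hS : Real.sqrt (∑' n : ℤ, (n : ℝ) ^ 2 * ‖f n‖ ^ 2) ≤ A * Real.sqrt M) :
    ‖∫ x in (-Real.pi)..Real.pi,
      Complex.exp (((2 * t * Real.cos x - ν * x : ℝ) : ℂ) * Complex.I) * discFT f x‖ ≤
      A * ((Real.pi ^ 2 + 4 * Real.pi) / M) := by
  have hpi := Real.pi_pos
  have hg := al_cont f (al_summable f hs)
  set E : ℝ → ℂ := fun x =>
    Complex.exp (((2 * t * Real.cos x - ν * x : ℝ) : ℂ) * Complex.I) with hE
  set q : ℝ → ℝ := fun x => 2 * t * Real.sin x + ν with hq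
  set q' : ℝ → ℝ := fun x => 2 * t * Real.cos x with hq'
  set D : ℝ → ℝ := fun x => q x ^ 2 + M ^ 2 with hD
  have hDpos : ∀ x, 0 < D x := fun x => by positivity
  have hqc : Continuous q := by fun_prop
  have hq'c : Continuous q' := by fun_prop
  have hDc : Continuous D := by fun_prop
  have hDi : Continuous (fun x => (D x)⁻¹) := hDc.inv₀ fun x => (hDpos x).ne'
  have hEc : Continuous E := by fun_prop
  have hEn : ∀ x, ‖E x‖ = 1 := fun x => Complex.norm_exp_ofReal_mul_I _
  set r : ℝ → ℝ := fun x => q' x * (M ^ 2 - q x ^ 2) * ((D x)⁻¹) ^ 2 with hr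
  have hrc : Continuous r := by fun_prop
  have hqd : ∀ x, HasDerivAt q (q' x) x := fun x =>
    ((Real.hasDerivAt_sin x).const_mul _).add_const _
  have hDd : ∀ x, HasDerivAt D (2 * q x * q' x) x := fun x =>
    (((hqd x).pow 2).add_const (M ^ 2)).congr_deriv (by simp)
  have hhd : ∀ x, HasDerivAt (fun y => q y / D y) (r x) x := fun x =>
    ((hqd x).div (hDd x) (hDpos x).ne').congr_deriv (by
      have := (hDpos x).ne'
      simp only [hr]
      field_simp
      simp only [hD]
      ring)
  have hEd : ∀ x, HasDerivAt E (E x * (((-q x : ℝ) : ℂ) * Complex.I)) x := by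
    intro x
    have h1 : HasDerivAt (fun x : ℝ => 2 * t * Real.cos x - ν * x) (-q x) x :=
      (((Real.hasDerivAt_cos x).const_mul (2 * t)).sub
        ((hasDerivAt_id x).const_mul ν)).congr_deriv (by simp only [hq]; ring)
    exact (h1.ofReal_comp.mul_const Complex.I).cexp
  set W : ℝ → ℂ := fun x => Complex.I * (E x * ((q x / D x : ℝ) : ℂ)) with hW
  set W' : ℝ → ℂ := fun x => E x * ((q x ^ 2 * (D x)⁻¹ : ℝ) : ℂ) +
    Complex.I * (E x * ((r x : ℝ) : ℂ)) with hW'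
  have hWd : ∀ x, HasDerivAt W (W' x) x := by
    intro x
    refine (((hEd x).mul (hhd x).ofReal_comp).const_mul Complex.I).congr_deriv ?_
    simp only [hW', div_eq_mul_inv]
    push_cast
    linear_combination (-(E x * q x ^ 2 * (D x : ℂ)⁻¹)) * Complex.I_sq
  have hW'c : Continuous W' := by fun_prop
  have hper : W Real.pi = W (-Real.pi) := by
    have hqq : q Real.pi = q (-Real.pi) := by simp [hq]
    have hEE : E Real.pi = E (-Real.pi) := by
      simp only [hE]
      rw [Complex.exp_eq_exp_iff_exists_int]
      refine ⟨-n, ?_⟩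
      rw [hν, Real.cos_neg]
      push_cast
      ring
    simp only [hW, hD, hqq, hEE]
  have hpair := al_pair f hs W W' hWd hW'c hper
  have hJ : ∫ x in (-Real.pi)..Real.pi, (D x)⁻¹ ≤ Real.pi ^ 2 / M ^ 3 := by
    have := al_J M ν hM
    rwa [← ht] at this ⊢
  have hV : ∫ x in (-Real.pi)..Real.pi, |q' x| * (D x)⁻¹ ≤ 3 * Real.pi / M :=
    al_var M ν t hM (by rw [ht]; positivity)
  have hWsq : ∫ x in (-Real.pi)..Real.pi, ‖W x‖ ^ 2 ≤ Real.pi ^ 2 / M ^ 3 := by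
    refine le_trans ?_ hJ
    have hWc : Continuous W := continuous_iff_continuousAt.2 fun x => (hWd x).continuousAt
    apply intervalIntegral.integral_mono_on (by linarith)
      ((by fun_prop : Continuous _).intervalIntegrable _ _) (hDi.intervalIntegrable _ _)
    intro x _
    have h0 := hDpos x
    simp only [hW]
    rw [norm_mul, norm_mul, hEn, Complex.norm_I, Complex.norm_real, Real.norm_eq_abs, one_mul,
      one_mul, sq_abs, div_pow, div_le_iff₀ (by positivity)]
    have : (D x)⁻¹ * D x ^ 2 = D x := by field_simp
    rw [this]
    simp only [hD]
    nlinarith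
  have hfirst : ‖∫ x in (-Real.pi)..Real.pi, W' x * discFT f x‖ ≤ A * (Real.pi / M) := by
    refine hpair.trans ((mul_le_mul hS (Real.sqrt_le_sqrt hWsq) (Real.sqrt_nonneg _)
      (by positivity)).trans (le_of_eq ?_))
    rw [mul_assoc, ← Real.sqrt_mul hM.le]
    congr 1
    rw [show M * (Real.pi ^ 2 / M ^ 3) = (Real.pi / M) ^ 2 by field_simp]
    exact Real.sqrt_sq (by positivity)
  set R : ℝ → ℂ := fun x => (E x * ((M ^ 2 * (D x)⁻¹ : ℝ) : ℂ) -
    Complex.I * (E x * ((r x : ℝ) : ℂ))) * discFT f x with hR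
  have hRc : Continuous R := by fun_prop
  have hsplit : ∫ x in (-Real.pi)..Real.pi, E x * discFT f x =
      (∫ x in (-Real.pi)..Real.pi, W' x * discFT f x) + ∫ x in (-Real.pi)..Real.pi, R x := by
    rw [← intervalIntegral.integral_add ((by fun_prop : Continuous (fun x => W' x * discFT f x)).intervalIntegrable _ _)
      (hRc.intervalIntegrable _ _)]
    congr 1
    funext x
    have h0 : ((q x ^ 2 * (D x)⁻¹ : ℝ) : ℂ) + ((M ^ 2 * (D x)⁻¹ : ℝ) : ℂ) = 1 := by
      rw [← Complex.ofReal_add, ← add_mul]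
      have : (q x ^ 2 + M ^ 2) * (D x)⁻¹ = 1 := mul_inv_cancel₀ (hDpos x).ne'
      rw [this, Complex.ofReal_one]
    simp only [hW', hR]
    linear_combination (-(E x * discFT f x)) * h0
  have hRn : ∀ x, ‖R x‖ ≤ A * (M ^ 2 * (D x)⁻¹ + |q' x| * (D x)⁻¹) := by
    intro x
    have h0 := hDpos x
    have h1 : |r x| ≤ |q' x| * (D x)⁻¹ := by
      simp only [hr]
      rw [abs_mul, abs_mul, abs_of_nonneg (by positivity : (0 : ℝ) ≤ ((D x)⁻¹) ^ 2), mul_assoc]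
      gcongr
      have h2 : |M ^ 2 - q x ^ 2| ≤ D x := by
        simp only [hD]
        rw [abs_le]; constructor <;> nlinarith
      calc _ ≤ D x * ((D x)⁻¹) ^ 2 := by gcongr
        _ = _ := by field_simp
    simp only [hR]
    rw [norm_mul, mul_comm]
    refine mul_le_mul (hf x) ?_ (norm_nonneg _) hA.le
    refine (norm_sub_le _ _).trans ?_
    rw [norm_mul, norm_mul, norm_mul, hEn, Complex.norm_I, Complex.norm_real, Complex.norm_real,
      one_mul, one_mul, one_mul, Real.norm_eq_abs, Real.norm_eq_abs, abs_of_nonneg (by positivity)]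
    linarith
  have hsecond : ‖∫ x in (-Real.pi)..Real.pi, R x‖ ≤
      A * (Real.pi ^ 2 / M + 3 * Real.pi / M) := by
    have hb1 : Continuous (fun x => M ^ 2 * (D x)⁻¹) := by fun_prop
    have hb2 : Continuous (fun x => |q' x| * (D x)⁻¹) := by fun_prop
    refine (intervalIntegral.norm_integral_le_of_norm_le (by linarith)
      (Filter.Eventually.of_forall fun x _ => hRn x)
      (((hb1.add hb2).const_mul A).intervalIntegrable _ _)).trans ?_
    rw [intervalIntegral.integral_const_mul, intervalIntegral.integral_add
      (hb1.intervalIntegrable _ _) (hb2.intervalIntegrable _ _),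
      intervalIntegral.integral_const_mul]
    have : Real.pi ^ 2 / M = M ^ 2 * (Real.pi ^ 2 / M ^ 3) := by field_simp
    rw [this]
    gcongr
  rw [hsplit]
  refine (norm_add_le _ _).trans ((add_le_add hfirst hsecond).trans (le_of_eq ?_))
  ring

/-- Dispersive decay for the linear Ablowitz–Ladik propagator: if `‖f̂‖_∞ ≤ A` and
`‖n f_n‖_{ℓ²} ≤ A t^{1/6}`, then `‖u(t)‖_{ℓ^∞} ≤ C A t^{−1/3}`. -/
theorem alProp_linear_decay :
    ∃ C : ℝ, 0 < C ∧ ∀ (t A : ℝ), 1 ≤ t → 0 < A → ∀ f : ℤ → ℂ,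
      (∀ ξ : ℝ, ‖discFT f ξ‖ ≤ A) →
      Summable (fun n : ℤ => (n : ℝ) ^ 2 * ‖f n‖ ^ 2) →
      Real.sqrt (∑' n : ℤ, (n : ℝ) ^ 2 * ‖f n‖ ^ 2) ≤ A * t ^ ((1 : ℝ) / 6) →
      ∀ n : ℤ, ‖alProp f t n‖ ≤ C * A * t ^ (-(1 : ℝ) / 3) := by
  have hpi := Real.pi_pos
  refine ⟨Real.pi ^ 2 + 4 * Real.pi, by positivity, ?_⟩
  intro t A ht hA f hf hs hS n
  have ht0 : 0 < t := by linarith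
  set M : ℝ := t ^ ((1 : ℝ) / 3) with hM
  have hM0 : 0 < M := by positivity
  have hM3 : t = M ^ 3 := by
    rw [hM, ← Real.rpow_natCast, ← Real.rpow_mul ht0.le]; norm_num
  have hMs : t ^ ((1 : ℝ) / 6) = Real.sqrt M := by
    rw [Real.sqrt_eq_rpow, hM, ← Real.rpow_mul ht0.le]; norm_num
  have hMi : t ^ (-(1 : ℝ) / 3) = M⁻¹ := by
    rw [hM, ← Real.rpow_neg ht0.le]; norm_num
  rw [hMs] at hS
  have h := al_phase M n t A n rfl hM0 hM3 hA f hf hs hS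
  have he : ∫ ξ in (-Real.pi)..Real.pi,
      Complex.exp (((2 * t * Real.cos ξ : ℝ) : ℂ) * Complex.I) * discFT f ξ *
        Complex.exp (-(Complex.I * (n : ℂ) * (ξ : ℂ))) = ∫ x in (-Real.pi)..Real.pi,
      Complex.exp (((2 * t * Real.cos x - n * x : ℝ) : ℂ) * Complex.I) * discFT f x := by
    congr 1
    funext x
    rw [mul_right_comm, ← Complex.exp_add]
    congr 2
    push_cast
    ring
  rw [alProp, he, norm_mul, norm_inv, Complex.norm_real, Real.norm_of_nonneg (Real.sqrt_nonneg _),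
    hMi]
  have h1 : (Real.sqrt (2 * Real.pi))⁻¹ ≤ 1 := by
    apply inv_le_one_of_one_le₀
    rw [Real.one_le_sqrt]
    linarith [Real.pi_gt_three]
  calc _ ≤ 1 * (A * ((Real.pi ^ 2 + 4 * Real.pi) / M)) := by gcongr
    _ = _ := by rw [div_eq_mul_inv]; ring
end

section
/- There exists a constant C > 0 with the following property. Let t ≥ 1, A > 0, and let f : ℤ → ℂ be a sequence such that its Fourier transform f̂(ξ) = (2π)^{-1/2} ∑_{n∈ℤ} f_n e^{inξ} satisfies |f̂(ξ)| ≤ A for all ξ, and such that (∑_{n∈ℤ} n²|f_n|²)^{1/2} ≤ A·t^{1/6}. Define u_n(t) = (2π)^{-1/2} ∫_{−π}^{π} e^{2it cos ξ} f̂(ξ) e^{−inξ} dξ. Then the bilinear quantity satisfies |u_n(t) · (u_{n+1}(t) + u_{n−1}(t))| ≤ C · A² · t^{−1} for all n ∈ ℤ. -/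
open Real in
lemma inv_sq_int (θ r p q : ℝ) (hr : 0 < r) (hpq : p ≤ q) (h : θ + r ≤ p ∨ q ≤ θ - r) :
    ∫ x in p..q, ((x - θ) ^ 2)⁻¹ ≤ 1 / r := by
  have hne : ∀ x ∈ Set.uIcc p q, x - θ ≠ 0 := by
    intro x hx
    rw [Set.uIcc_of_le hpq] at hx
    rcases h with h | h
    · have := hx.1; intro h0; linarith
    · have := hx.2; intro h0; linarith
  have : ∫ x in p..q, ((x - θ) ^ 2)⁻¹ = (-(q - θ)⁻¹) - (-(p - θ)⁻¹) := by
    apply intervalIntegral.integral_eq_sub_of_hasDerivAt (f := fun x => -(x - θ)⁻¹)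
    · intro x hx
      have h1 := (((hasDerivAt_id x).sub_const θ).inv (hne x hx)).neg
      refine HasDerivAt.congr_deriv h1 ?_
      simp [neg_div]
    · apply ContinuousOn.intervalIntegrable
      intro x hx
      apply ContinuousAt.continuousWithinAt
      have := hne x hx
      fun_prop (disch := positivity)
  rw [this]
  rcases h with h | h
  · have h1 : (p - θ)⁻¹ ≤ 1 / r := by
      rw [one_div]; apply inv_anti₀ hr; linarith
    have h2 : 0 ≤ (q - θ)⁻¹ := by apply inv_nonneg.2; linarith
    linarith
  · have h1 : (θ - q)⁻¹ ≤ 1 / r := by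
      rw [one_div]; apply inv_anti₀ hr; linarith
    have h2 : 0 ≤ (θ - p)⁻¹ := by apply inv_nonneg.2; linarith
    have e1 : (q - θ)⁻¹ = - (θ - q)⁻¹ := by rw [← inv_neg]; ring_nf
    have e2 : (p - θ)⁻¹ = - (θ - p)⁻¹ := by rw [← inv_neg]; ring_nf
    rw [e1, e2]; linarith

lemma ibp_bound (θ r p q K A : ℝ) (hr : 0 < r) (hpq : p ≤ q) (hK : 0 ≤ K) (hA : 0 < A)
    (h : θ + r ≤ p ∨ q ≤ θ - r) (φ φ' k k' : ℝ → ℝ) (g g' : ℝ → ℂ)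
    (hφ : ∀ x, HasDerivAt φ (φ' x) x) (hφ' : Continuous φ')
    (hk : ∀ x ∈ Set.Icc p q, HasDerivAt k (k' x) x) (hk' : ContinuousOn k' (Set.Icc p q))
    (hg : ∀ x, HasDerivAt g (g' x) x) (hg' : Continuous g')
    (bk : ∀ x ∈ Set.Icc p q, |k x| ≤ K * |x - θ|⁻¹)
    (bk' : ∀ x ∈ Set.Icc p q, |k' x| ≤ K * ((x - θ) ^ 2)⁻¹)
    (bg : ∀ x, ‖g x‖ ≤ A) (bg' : ∫ x in p..q, ‖g' x‖ ^ 2 ≤ A ^ 2 / r) :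
    ‖∫ x in p..q, Complex.exp (Complex.I * φ x) * ((φ' x * k x : ℝ) : ℂ) * g x‖
      ≤ 4 * K * A / r := by
  have hI := inv_sq_int θ r p q hr hpq h
  have hgc : Continuous g := continuous_iff_continuousAt.2 fun x => (hg x).continuousAt
  have hφc : Continuous φ := continuous_iff_continuousAt.2 fun x => (hφ x).continuousAt
  have hkc : ContinuousOn k (Set.Icc p q) := fun x hx => (hk x hx).continuousAt.continuousWithinAt
  have hdist : ∀ x ∈ Set.Icc p q, r ≤ |x - θ| := by
    intro x hx
    rcases h with h | h
    · rw [le_abs]; left; linarith [hx.1]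
    · rw [le_abs]; right; linarith [hx.2]
  have hu : Set.uIcc p q = Set.Icc p q := Set.uIcc_of_le hpq
  have hkr : ∀ x ∈ Set.Icc p q, |k x| ≤ K / r := by
    intro x hx
    refine (bk x hx).trans ?_
    rw [div_eq_mul_inv]
    exact mul_le_mul_of_nonneg_left (inv_anti₀ hr (hdist x hx)) hK
  set E : ℝ → ℂ := fun x => Complex.exp (Complex.I * φ x) with hE
  have hEn : ∀ x, ‖E x‖ = 1 := by
    intro x; simp only [hE]; rw [mul_comm]; exact Complex.norm_exp_ofReal_mul_I _
  have hEc : Continuous E := by fun_prop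
  have hEd : ∀ x, HasDerivAt E (E x * (Complex.I * φ' x)) x := by
    intro x
    exact (((hφ x).ofReal_comp).const_mul Complex.I).cexp
  have hF : ∀ x ∈ Set.uIcc p q, HasDerivAt (fun x => E x * (k x : ℂ) * g x)
      (Complex.I * (E x * ((φ' x * k x : ℝ) : ℂ) * g x)
        + E x * ((k' x : ℂ) * g x + (k x : ℂ) * g' x)) x := by
    intro x hx
    rw [hu] at hx
    have := ((hEd x).mul ((hk x hx).ofReal_comp)).mul (hg x)
    refine HasDerivAt.congr_deriv this ?_
    simp only [Pi.mul_apply]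
    push_cast
    ring
  have c1 : ContinuousOn (fun x => E x * ((φ' x * k x : ℝ) : ℂ) * g x) (Set.uIcc p q) := by
    rw [hu]
    refine (hEc.continuousOn.mul ?_).mul hgc.continuousOn
    exact Complex.continuous_ofReal.comp_continuousOn (hφ'.continuousOn.mul hkc)
  have c2 : ContinuousOn (fun x => E x * ((k' x : ℂ) * g x + (k x : ℂ) * g' x)) (Set.uIcc p q) := by
    rw [hu]
    refine (hEc.continuousOn.mul (ContinuousOn.add ?_ ?_))
    · exact (Complex.continuous_ofReal.comp_continuousOn hk').mul hgc.continuousOn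
    · exact (Complex.continuous_ofReal.comp_continuousOn hkc).mul hg'.continuousOn
  have i1 := c1.intervalIntegrable (μ := MeasureTheory.volume)
  have i2 := c2.intervalIntegrable (μ := MeasureTheory.volume)
  have hftc := intervalIntegral.integral_eq_sub_of_hasDerivAt hF ((i1.const_mul Complex.I).add i2)
  rw [intervalIntegral.integral_add (i1.const_mul _) i2, intervalIntegral.integral_const_mul] at hftc
  have bnd : ∀ x ∈ Set.Icc p q, ‖E x * (k x : ℂ) * g x‖ ≤ K / r * A := by
    intro x hx
    rw [norm_mul, norm_mul, hEn, one_mul, Complex.norm_real, Real.norm_eq_abs]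
    exact mul_le_mul (hkr x hx) (bg x) (norm_nonneg _) (by positivity)
  have b1 := bnd p (Set.left_mem_Icc.2 hpq)
  have b2 := bnd q (Set.right_mem_Icc.2 hpq)
  have isq : IntervalIntegrable (fun x : ℝ => ((x - θ) ^ 2)⁻¹) MeasureTheory.volume p q := by
    apply ContinuousOn.intervalIntegrable
    rw [hu]
    intro x hx
    apply ContinuousAt.continuousWithinAt
    have h0 : x - θ ≠ 0 := by
      have := hdist x hx
      intro h0; rw [h0] at this; simp at this; linarith
    fun_prop (disch := positivity)
  have ig : IntervalIntegrable (fun x : ℝ => ‖g' x‖ ^ 2) MeasureTheory.volume p q :=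
    (by fun_prop : Continuous (fun x : ℝ => ‖g' x‖ ^ 2)).intervalIntegrable _ _
  have b3 : ‖∫ x in p..q, E x * ((k' x : ℂ) * g x + (k x : ℂ) * g' x)‖ ≤ 2 * K * A / r := by
    have hb : ‖∫ x in p..q, E x * ((k' x : ℂ) * g x + (k x : ℂ) * g' x)‖ ≤
        ∫ x in p..q, ((3/2 * K * A) * ((x - θ) ^ 2)⁻¹ + (K / (2 * A)) * ‖g' x‖ ^ 2) := by
      apply intervalIntegral.norm_integral_le_of_norm_le hpq
      · refine Filter.Eventually.of_forall fun x hx => ?_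
        have hx' : x ∈ Set.Icc p q := Set.Ioc_subset_Icc_self hx
        rw [norm_mul, hEn, one_mul]
        refine (norm_add_le _ _).trans ?_
        rw [norm_mul, norm_mul, Complex.norm_real, Complex.norm_real, Real.norm_eq_abs,
          Real.norm_eq_abs]
        have e1 : |k' x| * ‖g x‖ ≤ K * ((x - θ) ^ 2)⁻¹ * A :=
          mul_le_mul (bk' x hx') (bg x) (norm_nonneg _) (by positivity)
        have e2 : |k x| * ‖g' x‖ ≤ K * |x - θ|⁻¹ * ‖g' x‖ :=
          mul_le_mul_of_nonneg_right (bk x hx') (norm_nonneg _)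
        have e3 : |x - θ|⁻¹ * ‖g' x‖ ≤ A / 2 * ((x - θ) ^ 2)⁻¹ + 1 / (2 * A) * ‖g' x‖ ^ 2 := by
          rw [← sq_abs (x - θ), ← inv_pow]
          have : A / 2 * |x - θ|⁻¹ ^ 2 + 1 / (2 * A) * ‖g' x‖ ^ 2 - |x - θ|⁻¹ * ‖g' x‖
            = (A * |x - θ|⁻¹ - ‖g' x‖) ^ 2 / (2 * A) := by
            generalize |x - θ|⁻¹ = y
            field_simp
            ring
          have h2 : 0 ≤ (A * |x - θ|⁻¹ - ‖g' x‖) ^ 2 / (2 * A) := by positivity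
          linarith
        have e4 := mul_le_mul_of_nonneg_left e3 hK
        calc _ ≤ K * ((x - θ) ^ 2)⁻¹ * A + K * (A / 2 * ((x - θ) ^ 2)⁻¹ + 1 / (2 * A) * ‖g' x‖ ^ 2) := by
              linarith
          _ = _ := by field_simp; ring
      · exact (isq.const_mul _).add (ig.const_mul _)
    rw [intervalIntegral.integral_add (isq.const_mul _) (ig.const_mul _),
      intervalIntegral.integral_const_mul, intervalIntegral.integral_const_mul] at hb
    refine hb.trans ?_
    have m1 := mul_le_mul_of_nonneg_left hI (by positivity : 0 ≤ 3/2 * K * A)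
    have m2 := mul_le_mul_of_nonneg_left bg' (by positivity : 0 ≤ K / (2 * A))
    refine (add_le_add m1 m2).trans (le_of_eq ?_)
    field_simp
    ring
  have key : ‖∫ x in p..q, E x * ((φ' x * k x : ℝ) : ℂ) * g x‖ =
      ‖Complex.I * ∫ x in p..q, E x * ((φ' x * k x : ℝ) : ℂ) * g x‖ := by
    rw [norm_mul, Complex.norm_I, one_mul]
  rw [key, eq_sub_of_add_eq hftc]
  refine (norm_sub_le _ _).trans ?_
  have := norm_sub_le (E q * (k q : ℂ) * g q) (E p * (k p : ℂ) * g p)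
  calc _ ≤ (K / r * A + K / r * A) + 2 * K * A / r := by
        gcongr
        linarith
    _ = _ := by field_simp; ring

lemma half_bound (θ r K A M : ℝ) (hr : 0 < r) (hK : 0 ≤ K) (hA : 0 < A) (hM : 0 ≤ M)
    (hθ0 : 0 ≤ θ) (hθ1 : θ ≤ Real.pi)
    (φ φ' k k' a : ℝ → ℝ) (g g' : ℝ → ℂ)
    (hφ : ∀ x, HasDerivAt φ (φ' x) x) (hφ' : Continuous φ') (ha : Continuous a)
    (hk : ∀ x ∈ Set.Icc 0 Real.pi, r ≤ |x - θ| → HasDerivAt k (k' x) x)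
    (hk' : ∀ x ∈ Set.Icc 0 Real.pi, r ≤ |x - θ| → ContinuousAt k' x)
    (hak : ∀ x ∈ Set.Icc 0 Real.pi, r ≤ |x - θ| → a x = φ' x * k x)
    (hg : ∀ x, HasDerivAt g (g' x) x) (hg' : Continuous g')
    (bk : ∀ x ∈ Set.Icc 0 Real.pi, r ≤ |x - θ| → |k x| ≤ K * |x - θ|⁻¹)
    (bk' : ∀ x ∈ Set.Icc 0 Real.pi, r ≤ |x - θ| → |k' x| ≤ K * ((x - θ) ^ 2)⁻¹)
    (ba : ∀ x ∈ Set.Icc 0 Real.pi, |x - θ| ≤ r → |a x| ≤ M)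
    (bg : ∀ x, ‖g x‖ ≤ A) (bg' : ∫ x in (0:ℝ)..Real.pi, ‖g' x‖ ^ 2 ≤ A ^ 2 / r) :
    ‖∫ x in (0:ℝ)..Real.pi, Complex.exp (Complex.I * φ x) * (a x : ℂ) * g x‖
      ≤ 2 * r * M * A + 8 * K * A / r := by
  have hgc : Continuous g := continuous_iff_continuousAt.2 fun x => (hg x).continuousAt
  have hφc : Continuous φ := continuous_iff_continuousAt.2 fun x => (hφ x).continuousAt
  have hpi := Real.pi_pos
  set F : ℝ → ℂ := fun x => Complex.exp (Complex.I * φ x) * (a x : ℂ) * g x with hF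
  have hFc : Continuous F := by fun_prop
  have hFi : ∀ p q, IntervalIntegrable F MeasureTheory.volume p q :=
    fun p q => hFc.intervalIntegrable p q
  have outer : ∀ p q, 0 ≤ p → q ≤ Real.pi → p ≤ q → (θ + r ≤ p ∨ q ≤ θ - r) →
      ‖∫ x in p..q, F x‖ ≤ 4 * K * A / r := by
    intro p q hp hq hpq h
    have hd : ∀ x ∈ Set.Icc p q, x ∈ Set.Icc 0 Real.pi ∧ r ≤ |x - θ| := by
      intro x hx
      refine ⟨⟨hp.trans hx.1, hx.2.trans hq⟩, ?_⟩
      rcases h with h | h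
      · rw [le_abs]; left; linarith [hx.1]
      · rw [le_abs]; right; linarith [hx.2]
    have := ibp_bound θ r p q K A hr hpq hK hA h φ φ' k k' g g' hφ hφ'
      (fun x hx => hk x (hd x hx).1 (hd x hx).2)
      (fun x hx => (hk' x (hd x hx).1 (hd x hx).2).continuousWithinAt) hg hg'
      (fun x hx => bk x (hd x hx).1 (hd x hx).2)
      (fun x hx => bk' x (hd x hx).1 (hd x hx).2) bg ?_
    · rw [intervalIntegral.integral_congr (g := fun x => Complex.exp (Complex.I * φ x) *
        ((φ' x * k x : ℝ) : ℂ) * g x)]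
      · exact this
      · intro x hx
        rw [Set.uIcc_of_le hpq] at hx
        simp only [hF]
        rw [hak x (hd x hx).1 (hd x hx).2]
    · refine le_trans ?_ bg'
      apply intervalIntegral.integral_mono_interval hp hpq hq
      · exact Filter.Eventually.of_forall fun x => by positivity
      · exact (by fun_prop : Continuous (fun x : ℝ => ‖g' x‖ ^ 2)).intervalIntegrable _ _
  have hpos : 0 ≤ 4 * K * A / r := by positivity
  have o1 : ‖∫ x in (0:ℝ)..(max 0 (θ - r)), F x‖ ≤ 4 * K * A / r := by
    rcases le_total (θ - r) 0 with h | h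
    · rw [max_eq_left h]; simpa using hpos
    · rw [max_eq_right h]
      exact outer 0 _ le_rfl (by linarith) h (Or.inr le_rfl)
  have o2 : ‖∫ x in (min Real.pi (θ + r))..Real.pi, F x‖ ≤ 4 * K * A / r := by
    rcases le_total Real.pi (θ + r) with h | h
    · rw [min_eq_left h]; simpa using hpos
    · rw [min_eq_right h]
      exact outer _ _ (by linarith) le_rfl h (Or.inl le_rfl)
  have hmm : max 0 (θ - r) ≤ min Real.pi (θ + r) := by
    apply max_le <;> apply le_min <;> linarith
  have o3 : ‖∫ x in (max 0 (θ - r))..(min Real.pi (θ + r)), F x‖ ≤ 2 * r * M * A := by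
    have := intervalIntegral.norm_integral_le_of_norm_le_const (a := max 0 (θ - r))
      (b := min Real.pi (θ + r)) (f := F) (C := M * A) ?_
    · refine this.trans ?_
      rw [abs_of_nonneg (sub_nonneg.2 hmm)]
      have : min Real.pi (θ + r) - max 0 (θ - r) ≤ 2 * r := by
        have := min_le_right Real.pi (θ + r)
        have := le_max_right 0 (θ - r)
        linarith
      have := mul_le_mul_of_nonneg_left this (by positivity : 0 ≤ M * A)
      linarith
    · intro x hx
      rw [Set.uIoc_of_le hmm] at hx
      have h1 := max_lt_iff.1 hx.1
      have h2 := le_min_iff.1 hx.2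
      simp only [hF]
      rw [norm_mul, norm_mul, mul_comm Complex.I, Complex.norm_exp_ofReal_mul_I, one_mul,
        Complex.norm_real, Real.norm_eq_abs]
      refine mul_le_mul (ba x ⟨h1.1.le, h2.1⟩ ?_) (bg x) (norm_nonneg _) hM
      rw [abs_le]; constructor <;> linarith
  rw [← intervalIntegral.integral_add_adjacent_intervals (hFi 0 (max 0 (θ - r))) (hFi _ Real.pi),
    ← intervalIntegral.integral_add_adjacent_intervals (hFi (max 0 (θ - r)) (min Real.pi (θ + r)))
      (hFi _ Real.pi)]
  refine (norm_add_le _ _).trans ?_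
  have := norm_add_le (∫ x in (max 0 (θ - r))..(min Real.pi (θ + r)), F x)
    (∫ x in (min Real.pi (θ + r))..Real.pi, F x)
  have e : 8 * K * A / r = 2 * (4 * K * A / r) := by ring
  rw [e]
  linarith

lemma sin_low (y : ℝ) (h0 : 0 ≤ y) (h1 : y ≤ 3 * Real.pi / 4) : y / 5 ≤ Real.sin y := by
  have hp := Real.pi_gt_three
  have hp2 := Real.pi_lt_d2
  rcases le_total y (Real.pi / 2) with h | h
  · have := Real.mul_le_sin h0 h
    have h3 : (1:ℝ)/5 ≤ 2 / Real.pi := by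
      rw [div_le_div_iff₀ (by norm_num) (by linarith)]; linarith
    have := mul_le_mul_of_nonneg_right h3 h0
    linarith
  · have h4 := Real.mul_le_sin (x := Real.pi - y) (by linarith) (by linarith)
    rw [Real.sin_pi_sub] at h4
    have : 2 / Real.pi * (Real.pi / 4) ≤ 2 / Real.pi * (Real.pi - y) := by
      apply mul_le_mul_of_nonneg_left _ (by positivity); linarith
    have e : 2 / Real.pi * (Real.pi / 4) = 1 / 2 := by field_simp; norm_num
    linarith

lemma cos_low1 (x θ : ℝ) (h0 : 0 ≤ x) (h1 : x ≤ Real.pi) (k0 : 0 ≤ θ) (k1 : θ ≤ Real.pi / 2) :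
    |x - θ| * (x + θ) / 20 ≤ |Real.cos x - Real.cos θ| := by
  have hp := Real.pi_gt_three
  have hp2 := Real.pi_lt_d2
  rw [Real.cos_sub_cos, abs_mul, abs_mul]
  have s1 := sin_low ((x + θ) / 2) (by linarith) (by linarith)
  have s2 : |x - θ| / 4 ≤ |Real.sin ((x - θ) / 2)| := by
    have : |Real.sin ((x - θ) / 2)| ≥ 2 / Real.pi * |(x - θ) / 2| := by
      apply Real.mul_abs_le_abs_sin
      rw [abs_le]; constructor <;> linarith
    rw [abs_div, abs_two] at this
    have h3 : (1:ℝ)/2 ≤ 2 / Real.pi := by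
      rw [div_le_div_iff₀ (by norm_num) (by linarith)]; linarith
    have := mul_le_mul_of_nonneg_right h3 (by positivity : 0 ≤ |x - θ| / 2)
    linarith
  have s3 : (x + θ) / 10 ≤ |Real.sin ((x + θ) / 2)| := by
    refine le_trans ?_ (le_abs_self _); linarith
  have := mul_le_mul s3 s2 (by positivity) (by positivity)
  norm_num
  nlinarith

lemma cos_low (x c : ℝ) (h0 : 0 ≤ x) (h1 : x ≤ Real.pi) (hc : 0 ≤ c) :
    |x - Real.arccos c| * (x + Real.arccos c) / 20 ≤ |Real.cos x - c| := by
  rcases le_total c 1 with h | h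
  · have := cos_low1 x (Real.arccos c) h0 h1 (Real.arccos_nonneg c) (Real.arccos_le_pi_div_two.2 hc)
    rwa [Real.cos_arccos (by linarith) h] at this
  · have := cos_low1 x 0 h0 h1 le_rfl (by positivity)
    rw [Real.arccos_of_one_le h]
    refine this.trans ?_
    have := Real.cos_le_one x
    rw [Real.cos_zero, abs_of_nonpos (by linarith), abs_of_nonpos (by linarith)]
    linarith

lemma num_up (x c : ℝ) (h0 : 0 ≤ x) (h1 : x ≤ Real.pi) (hc : 0 ≤ c) :
    |1 - c * Real.cos x| * (x - Real.arccos c) ^ 2 ≤ 400 * (Real.cos x - c) ^ 2 := by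
  have hl := cos_low x c h0 h1 hc
  have hθ := Real.arccos_nonneg c
  have hx1 := Real.cos_le_one x
  have hx2 := Real.neg_one_le_cos x
  have hx3 := Real.one_sub_sq_div_two_le_cos (x := x)
  rcases le_total c 1 with h | h
  · have hc3 := Real.one_sub_sq_div_two_le_cos (x := Real.arccos c)
    rw [Real.cos_arccos (by linarith) h] at hc3
    set θ := Real.arccos c
    have hn : 0 ≤ 1 - c * Real.cos x := by nlinarith
    have hu : 1 - c * Real.cos x ≤ (x + θ) ^ 2 := by
      nlinarith [mul_nonneg (sub_nonneg.2 h) (sub_nonneg.2 hx1), mul_nonneg h0 hθ]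
    rw [abs_of_nonneg hn]
    have h2 : (|x - θ| * (x + θ) / 20) ^ 2 ≤ |Real.cos x - c| ^ 2 :=
      pow_le_pow_left₀ (by positivity) hl 2
    rw [sq_abs, div_pow, mul_pow, sq_abs] at h2
    have := mul_le_mul_of_nonneg_right hu (sq_nonneg (x - θ))
    linarith
  · rw [Real.arccos_of_one_le h] at hl ⊢
    simp only [sub_zero, add_zero] at hl ⊢
    rw [abs_of_nonneg h0, abs_of_nonpos (by linarith : Real.cos x - c ≤ 0)] at hl
    have h3 : |1 - c * Real.cos x| ≤ 3 * (c - Real.cos x) := by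
      rw [abs_le]; constructor <;> nlinarith
    have h4 : x ^ 2 ≤ 20 * (c - Real.cos x) := by nlinarith
    have := mul_le_mul h3 h4 (by positivity) (by linarith)
    nlinarith [sq_nonneg (c - Real.cos x)]

/-- choice of the scales -/
lemma scales (t θ : ℝ) (ht : 1 ≤ t) (hθ : 0 ≤ θ) : ∃ r δ : ℝ, 0 < r ∧ 0 < δ ∧ t * r ^ 2 * δ = 1 ∧
    t ^ ((1:ℝ)/3) * r ≤ 1 ∧ r ≤ δ ∧ θ ≤ δ ∧ (δ ≤ θ ∨ δ ≤ r) := by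
  have ht0 : 0 < t := by linarith
  set s := t ^ ((1:ℝ)/3) with hs
  have hs0 : 0 < s := by positivity
  have hs3 : s ^ 3 = t := by
    rw [hs, ← Real.rpow_natCast, ← Real.rpow_mul ht0.le]; norm_num
  rcases le_total s⁻¹ θ with h | h
  · have hθ0 : 0 < θ := lt_of_lt_of_le (by positivity) h
    have h1 : 1 ≤ s * θ := by
      have := mul_le_mul_of_nonneg_left h hs0.le
      rwa [mul_inv_cancel₀ hs0.ne'] at this
    have hq : 0 < Real.sqrt (t * θ) := by positivity
    have hq2 : Real.sqrt (t * θ) ^ 2 = t * θ := Real.sq_sqrt (by positivity)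
    have hsq : s ≤ Real.sqrt (t * θ) := by
      apply Real.le_sqrt_of_sq_le
      rw [← hs3]
      nlinarith [mul_le_mul_of_nonneg_left h1 (sq_nonneg s)]
    refine ⟨(Real.sqrt (t * θ))⁻¹, θ, by positivity, hθ0, ?_, ?_, ?_, le_rfl, Or.inl le_rfl⟩
    · rw [inv_pow, hq2]; field_simp
    · rw [← div_eq_mul_inv, div_le_one hq]; exact hsq
    · exact (inv_anti₀ hs0 hsq).trans h
  · refine ⟨s⁻¹, s⁻¹, by positivity, by positivity, ?_, ?_, le_rfl, h, Or.inr le_rfl⟩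
    · rw [← hs3]; field_simp
    · rw [mul_inv_cancel₀ hs0.ne']

lemma main_half (t c r δ A : ℝ) (ht : 1 ≤ t) (hc : 0 ≤ c) (hA : 0 < A) (hr : 0 < r) (hδ : 0 < δ)
    (h1 : t * r ^ 2 * δ = 1) (h2 : t ^ ((1:ℝ)/3) * r ≤ 1) (h3 : r ≤ δ) (h4 : Real.arccos c ≤ δ)
    (h5 : δ ≤ Real.arccos c ∨ δ ≤ r) (g g' : ℝ → ℂ)
    (hg : ∀ x, HasDerivAt g (g' x) x) (hg' : Continuous g')
    (bg : ∀ x, ‖g x‖ ≤ A)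
    (bg' : ∫ x in (0:ℝ)..Real.pi, ‖g' x‖ ^ 2 ≤ A ^ 2 * t ^ ((1:ℝ)/3)) :
    ‖∫ x in (0:ℝ)..Real.pi, Complex.exp (Complex.I * ((2 * t * (Real.sin x - c * x) : ℝ) : ℂ)) * g x‖
      ≤ 1604 * A * r ∧
    ‖∫ x in (0:ℝ)..Real.pi, Complex.exp (Complex.I * ((2 * t * (Real.sin x - c * x) : ℝ) : ℂ)) *
      (Real.sin x : ℂ) * g x‖ ≤ 1604 * A * r * δ := by
  have ht0 : 0 < t := by linarith
  set θ := Real.arccos c with hθ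
  have hθ0 : 0 ≤ θ := Real.arccos_nonneg c
  have hθ1 : θ ≤ Real.pi := Real.arccos_le_pi c
  have bg2 : ∫ x in (0:ℝ)..Real.pi, ‖g' x‖ ^ 2 ≤ A ^ 2 / r := by
    refine bg'.trans ?_
    rw [le_div_iff₀ hr, mul_assoc]
    have := mul_le_mul_of_nonneg_left h2 (sq_nonneg A)
    linarith
  have hlow : ∀ x ∈ Set.Icc 0 Real.pi, r ≤ |x - θ| → δ ≤ x + θ := by
    intro x hx hd
    rcases h5 with h | h
    · linarith [hx.1]
    · rcases le_abs.1 hd with h6 | h6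
      · linarith
      · linarith [hx.1]
  have hD : ∀ x ∈ Set.Icc 0 Real.pi, |x - θ| * (x + θ) / 20 ≤ |Real.cos x - c| :=
    fun x hx => cos_low x c hx.1 hx.2 hc
  have hne : ∀ x ∈ Set.Icc 0 Real.pi, r ≤ |x - θ| → Real.cos x - c ≠ 0 := by
    intro x hx hd
    rw [← abs_pos]
    have h7 : 0 < |x - θ| := by linarith
    have h8 : 0 < x + θ := by linarith [hlow x hx hd]
    exact lt_of_lt_of_le (by positivity) (hD x hx)
  have hφ : ∀ x, HasDerivAt (fun x => 2 * t * (Real.sin x - c * x)) (2 * t * (Real.cos x - c)) x := by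
    intro x
    have := ((Real.hasDerivAt_sin x).sub ((hasDerivAt_id x).const_mul c)).const_mul (2 * t)
    simpa using this
  have hφ' : Continuous (fun x => 2 * t * (Real.cos x - c)) := by fun_prop
  have eδ : 1 / (t * δ) = r ^ 2 := by field_simp; linarith
  have et : 1 / t = r ^ 2 * δ := by field_simp; linarith
  constructor
  · have := half_bound θ r (200 * r ^ 2) A 1 hr (by positivity) hA zero_le_one hθ0 hθ1
      (fun x => 2 * t * (Real.sin x - c * x)) (fun x => 2 * t * (Real.cos x - c))
      (fun x => (2 * t * (Real.cos x - c))⁻¹)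
      (fun x => 2 * t * Real.sin x / (2 * t * (Real.cos x - c)) ^ 2) (fun _ => 1) g g'
      hφ hφ' continuous_const ?_ ?_ ?_ hg hg' ?_ ?_ ?_ bg bg2
    · simp only [Complex.ofReal_one, mul_one] at this
      refine this.trans (le_of_eq_of_le (b := 1602 * A * r) ?_ ?_)
      · field_simp; ring
      · nlinarith [mul_pos hA hr]
    · intro x hx hd
      have h0 : 2 * t * (Real.cos x - c) ≠ 0 := mul_ne_zero (by positivity) (hne x hx hd)
      have := ((((Real.hasDerivAt_cos x).sub_const c).const_mul (2 * t))).inv h0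
      refine HasDerivAt.congr_deriv this ?_
      ring
    · intro x hx hd
      have h0 : 2 * t * (Real.cos x - c) ≠ 0 := mul_ne_zero (by positivity) (hne x hx hd)
      have : (2 * t * (Real.cos x - c)) ^ 2 ≠ 0 := pow_ne_zero 2 h0
      fun_prop (disch := assumption)
    · intro x hx hd
      have h0 : 2 * t * (Real.cos x - c) ≠ 0 := mul_ne_zero (by positivity) (hne x hx hd)
      exact (mul_inv_cancel₀ h0).symm
    · intro x hx hd
      have h7 : 0 < |x - θ| := by linarith
      have hl := hlow x hx hd
      have hd' := hD x hx
      rw [abs_inv, abs_mul, abs_of_pos (by positivity : 0 < 2 * t)]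
      have h9 : t * δ * |x - θ| / 10 ≤ 2 * t * |Real.cos x - c| := by
        have := mul_le_mul_of_nonneg_left hl h7.le
        nlinarith
      refine (inv_anti₀ (by positivity) h9).trans ?_
      rw [← eδ]
      have : (t * δ * |x - θ| / 10)⁻¹ = 10 * (1 / (t * δ)) * |x - θ|⁻¹ := by field_simp
      rw [this]
      gcongr
      norm_num
    · intro x hx hd
      have h7 : 0 < |x - θ| := by linarith
      have hl := hlow x hx hd
      have hl0 : 0 < x + θ := by linarith
      have hd' := hD x hx
      have hs0 := Real.sin_nonneg_of_nonneg_of_le_pi hx.1 hx.2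
      have hs1 := Real.sin_le hx.1
      have h10 : (|x - θ| * (x + θ) / 20) ^ 2 ≤ (Real.cos x - c) ^ 2 := by
        rw [← sq_abs (Real.cos x - c)]
        exact pow_le_pow_left₀ (by positivity) hd' 2
      rw [div_pow, mul_pow, sq_abs] at h10
      have hxθ : 0 < (x - θ) ^ 2 := by rw [← sq_abs]; positivity
      have hcp : 0 < (Real.cos x - c) ^ 2 := by
        have := hne x hx hd; positivity
      rw [abs_of_nonneg (by positivity), ← eδ]
      have e1 : 2 * t * Real.sin x / (2 * t * (Real.cos x - c)) ^ 2 =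
        Real.sin x / (2 * t * (Real.cos x - c) ^ 2) := by field_simp
      have e2 : 200 * (1 / (t * δ)) * ((x - θ) ^ 2)⁻¹ = 200 / (t * δ * (x - θ) ^ 2) := by field_simp
      rw [e1, e2, div_le_div_iff₀ (by positivity) (by positivity)]
      have : Real.sin x * δ ≤ (x + θ) ^ 2 := by
        rw [sq]
        exact mul_le_mul (by linarith) hl hδ.le hl0.le
      have h11 := mul_le_mul_of_nonneg_right this hxθ.le
      have h12 : Real.sin x * δ * (x - θ) ^ 2 ≤ 400 * (Real.cos x - c) ^ 2 := by linarith
      have h13 := mul_le_mul_of_nonneg_left h12 ht0.le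
      linarith
    · intro x _ _
      simp
  · have := half_bound θ r (200 * (r ^ 2 * δ)) A (2 * δ) hr (by positivity) hA (by positivity) hθ0 hθ1
      (fun x => 2 * t * (Real.sin x - c * x)) (fun x => 2 * t * (Real.cos x - c))
      (fun x => Real.sin x / (2 * t * (Real.cos x - c)))
      (fun x => 2 * t * (1 - c * Real.cos x) / (2 * t * (Real.cos x - c)) ^ 2) Real.sin g g'
      hφ hφ' Real.continuous_sin ?_ ?_ ?_ hg hg' ?_ ?_ ?_ bg bg2
    · refine this.trans (le_of_eq (b := 1604 * A * r * δ) ?_)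
      field_simp; ring
    · intro x hx hd
      have h0 : 2 * t * (Real.cos x - c) ≠ 0 := mul_ne_zero (by positivity) (hne x hx hd)
      have := (Real.hasDerivAt_sin x).div (((Real.hasDerivAt_cos x).sub_const c).const_mul (2 * t)) h0
      refine HasDerivAt.congr_deriv this ?_
      congr 1
      linear_combination (2 * t) * Real.sin_sq_add_cos_sq x
    · intro x hx hd
      have h0 : 2 * t * (Real.cos x - c) ≠ 0 := mul_ne_zero (by positivity) (hne x hx hd)
      have : (2 * t * (Real.cos x - c)) ^ 2 ≠ 0 := pow_ne_zero 2 h0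
      fun_prop (disch := assumption)
    · intro x hx hd
      have h0 : 2 * t * (Real.cos x - c) ≠ 0 := mul_ne_zero (by positivity) (hne x hx hd)
      exact (mul_div_cancel₀ _ h0).symm
    · intro x hx hd
      have h7 : 0 < |x - θ| := by linarith
      have hl0 : 0 < x + θ := by linarith [hlow x hx hd]
      have hd' := hD x hx
      have hs0 := Real.sin_nonneg_of_nonneg_of_le_pi hx.1 hx.2
      have hs1 := Real.sin_le hx.1
      have hcp : 0 < |Real.cos x - c| := abs_pos.2 (hne x hx hd)
      rw [abs_div, abs_mul, abs_of_pos (by positivity : 0 < 2 * t), abs_of_nonneg hs0, ← et]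
      have e2 : 200 * (1 / t) * |x - θ|⁻¹ = 200 / (t * |x - θ|) := by field_simp
      rw [e2, div_le_div_iff₀ (by positivity) (by positivity)]
      have h8 : Real.sin x * |x - θ| ≤ 20 * |Real.cos x - c| := by
        have := mul_le_mul_of_nonneg_right (by linarith : Real.sin x ≤ x + θ) h7.le
        linarith
      have := mul_le_mul_of_nonneg_left h8 ht0.le
      nlinarith [mul_pos ht0 hcp]
    · intro x hx hd
      have h7 : 0 < |x - θ| := by linarith
      have hxθ : 0 < (x - θ) ^ 2 := by rw [← sq_abs]; positivity
      have hcp : 0 < (Real.cos x - c) ^ 2 := by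
        have := hne x hx hd; positivity
      have hn := num_up x c hx.1 hx.2 hc
      rw [abs_div, abs_mul, abs_of_pos (by positivity : 0 < 2 * t), abs_of_nonneg (sq_nonneg (2 * t * (Real.cos x - c))), ← et]
      have e1 : 2 * t * |1 - c * Real.cos x| / (2 * t * (Real.cos x - c)) ^ 2 =
        |1 - c * Real.cos x| / (2 * t * (Real.cos x - c) ^ 2) := by field_simp
      have e2 : 200 * (1 / t) * ((x - θ) ^ 2)⁻¹ = 200 / (t * (x - θ) ^ 2) := by field_simp
      rw [e1, e2, div_le_div_iff₀ (by positivity) (by positivity)]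
      have := mul_le_mul_of_nonneg_left hn ht0.le
      linarith
    · intro x hx hd
      rw [abs_of_nonneg (Real.sin_nonneg_of_nonneg_of_le_pi hx.1 hx.2)]
      have := Real.sin_le hx.1
      have := (abs_le.1 hd).2
      linarith

/-- The oscillatory integral over the circle. -/
noncomputable def oscW (t : ℝ) (n : ℤ) (a : ℝ → ℝ) (g : ℝ → ℂ) : ℂ :=
  ∫ ξ in (-Real.pi)..Real.pi,
      Complex.exp (((2 * t * Real.cos ξ : ℝ) : ℂ) * Complex.I) * ((a ξ : ℂ) * g ξ) *
        Complex.exp (-(Complex.I * (n : ℂ) * (ξ : ℂ)))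

lemma periodic_shift {E : Type*} [NormedAddCommGroup E] [NormedSpace ℝ E] (G : ℝ → E)
    (hG : Function.Periodic G (2 * Real.pi)) :
    ∫ x in (-Real.pi)..Real.pi, G x = ∫ x in (-Real.pi)..Real.pi, G (x - Real.pi / 2) := by
  rw [intervalIntegral.integral_comp_sub_right]
  have := hG.intervalIntegral_add_eq (-Real.pi) (-Real.pi - Real.pi / 2)
  convert this using 2 <;> ring

lemma fold {E : Type*} [NormedAddCommGroup E] [NormedSpace ℝ E] (G : ℝ → E)
    (hG : Function.Periodic G (2 * Real.pi)) (hc : Continuous G) :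
    ∫ x in (-Real.pi)..Real.pi, G x = (∫ x in (0:ℝ)..Real.pi, G (x - Real.pi / 2)) +
      ∫ x in (0:ℝ)..Real.pi, G (-x - Real.pi / 2) := by
  rw [periodic_shift G hG]
  have hc' : Continuous (fun x => G (x - Real.pi / 2)) := by fun_prop
  rw [← intervalIntegral.integral_add_adjacent_intervals (hc'.intervalIntegrable _ 0)
    (hc'.intervalIntegrable 0 _), add_comm]
  congr 1
  have := intervalIntegral.integral_comp_neg (a := 0) (b := Real.pi)
    (fun x => G (x - Real.pi / 2))
  rw [this, neg_zero]

lemma osc_reflect (t : ℝ) (n : ℤ) (a : ℝ → ℝ) (g : ℝ → ℂ) (ha : ∀ x, a (-x) = a x) :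
    oscW t n a g = oscW t (-n) a (fun x => g (-x)) := by
  unfold oscW
  have := intervalIntegral.integral_comp_neg (a := -Real.pi) (b := Real.pi)
    (fun ξ => Complex.exp (((2 * t * Real.cos ξ : ℝ) : ℂ) * Complex.I) * ((a ξ : ℂ) * g ξ) *
        Complex.exp (-(Complex.I * (n : ℂ) * (ξ : ℂ))))
  rw [neg_neg] at this
  rw [← this]
  congr 1
  ext x
  simp only [ha, Real.cos_neg]
  congr 2
  push_cast
  ring

lemma osc_bound (t A r : ℝ) (n : ℤ) (ht : 0 < t) (M : ℝ) (a b : ℝ → ℝ) (g g' : ℝ → ℂ)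
    (hac : Continuous a) (hap : Function.Periodic a (2 * Real.pi))
    (σ : ℝ) (hσ : |σ| = 1)
    (hab1 : ∀ x, a (x - Real.pi / 2) = b x) (hab2 : ∀ x, a (-x - Real.pi / 2) = σ * b x)
    (hg : ∀ x, HasDerivAt g (g' x) x) (hg' : Continuous g')
    (hp : Function.Periodic g (2 * Real.pi)) (hp' : Function.Periodic g' (2 * Real.pi))
    (bg : ∀ x, ‖g x‖ ≤ A)
    (bg' : ∫ x in (-Real.pi)..Real.pi, ‖g' x‖ ^ 2 ≤ r)
    (H : ∀ G G' : ℝ → ℂ, (∀ x, HasDerivAt G (G' x) x) → Continuous G' → (∀ x, ‖G x‖ ≤ A) →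
      ∫ x in (0:ℝ)..Real.pi, ‖G' x‖ ^ 2 ≤ r →
      ‖∫ x in (0:ℝ)..Real.pi, Complex.exp (Complex.I *
        ((2 * t * (Real.sin x - (n / (2 * t)) * x) : ℝ) : ℂ)) * (b x : ℂ) * G x‖ ≤ M) :
    ‖oscW t n a g‖ ≤ 2 * M := by
  have hgc : Continuous g := continuous_iff_continuousAt.2 fun x => (hg x).continuousAt
  set ω : ℂ := Complex.exp (Complex.I * ((n * (Real.pi / 2) : ℝ) : ℂ)) with hω
  have hωn : ‖ω‖ = 1 := by
    rw [hω, mul_comm]; exact Complex.norm_exp_ofReal_mul_I _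
  have hsq := fold (fun x => ‖g' x‖ ^ 2) (fun x => by simp only [hp' x]) (by fun_prop)
  rw [hsq] at bg'
  have hpi := Real.pi_pos
  have n1 : 0 ≤ ∫ x in (0:ℝ)..Real.pi, ‖g' (x - Real.pi / 2)‖ ^ 2 :=
    intervalIntegral.integral_nonneg hpi.le fun x _ => by positivity
  have n2 : 0 ≤ ∫ x in (0:ℝ)..Real.pi, ‖g' (-x - Real.pi / 2)‖ ^ 2 :=
    intervalIntegral.integral_nonneg hpi.le fun x _ => by positivity
  unfold oscW
  rw [fold]
  · refine (norm_add_le _ _).trans ?_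
    refine (add_le_add (a := _) (b := M) (c := _) (d := M) ?_ ?_).trans_eq (two_mul M).symm
    · have := H (fun x => ω * g (x - Real.pi / 2)) (fun x => ω * g' (x - Real.pi / 2)) ?_ ?_ ?_ ?_
      · refine le_of_eq_of_le ?_ this
        congr 2
        ext x
        rw [hab1, Real.cos_sub_pi_div_two]
        have : Complex.exp (((2 * t * Real.sin x : ℝ) : ℂ) * Complex.I) *
            Complex.exp (-(Complex.I * (n : ℂ) * ((x - Real.pi / 2 : ℝ) : ℂ))) =
            Complex.exp (Complex.I *
              ((2 * t * (Real.sin x - (n / (2 * t)) * x) : ℝ) : ℂ)) * ω := by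
          rw [hω, ← Complex.exp_add, ← Complex.exp_add]
          congr 1
          have htc : (t : ℂ) ≠ 0 := by exact_mod_cast ht.ne'
          push_cast
          field_simp
          ring
        linear_combination ((b x : ℂ) * g (x - Real.pi / 2)) * this
      · intro x
        exact ((hg _).comp_sub_const x (Real.pi / 2)).const_mul ω
      · fun_prop
      · intro x; rw [norm_mul, hωn, one_mul]; exact bg _
      · simp only [norm_mul, hωn, one_mul]; linarith
    · have := H (fun x => starRingEnd ℂ (ω * g (-x - Real.pi / 2)))
        (fun x => starRingEnd ℂ (ω * -g' (-x - Real.pi / 2))) ?_ ?_ ?_ ?_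
      · refine le_of_eq_of_le ?_ this
        rw [← Complex.norm_conj, ← intervalIntegral.intervalIntegral_conj]
        rw [← one_mul ‖∫ x in (0:ℝ)..Real.pi, Complex.exp (Complex.I *
          ((2 * t * (Real.sin x - (n / (2 * t)) * x) : ℝ) : ℂ)) * (b x : ℂ) * 
            starRingEnd ℂ (ω * g (-x - Real.pi / 2))‖, ← hσ, ← Real.norm_eq_abs,
            ← Complex.norm_real, ← norm_mul, ← intervalIntegral.integral_const_mul]
        congr 2
        ext x
        rw [hab2]
        have hcos : Real.cos (-x - Real.pi / 2) = - Real.sin x := by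
          rw [← Real.cos_neg, ← Real.cos_add_pi_div_two]; congr 1; ring
        rw [hcos]
        have : starRingEnd ℂ (Complex.exp (((2 * t * -Real.sin x : ℝ) : ℂ) * Complex.I)) *
            starRingEnd ℂ (Complex.exp (-(Complex.I * (n : ℂ) * ((-x - Real.pi / 2 : ℝ) : ℂ)))) =
            Complex.exp (Complex.I *
              ((2 * t * (Real.sin x - (n / (2 * t)) * x) : ℝ) : ℂ)) * starRingEnd ℂ ω := by
          rw [hω, ← Complex.exp_conj, ← Complex.exp_conj, ← Complex.exp_conj, ← Complex.exp_add,
            ← Complex.exp_add]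
          congr 1
          have htc : (t : ℂ) ≠ 0 := by exact_mod_cast ht.ne'
          simp only [map_mul, map_neg, Complex.conj_ofReal, Complex.conj_I, map_intCast]
          push_cast
          field_simp
          ring
        simp only [map_mul, Complex.conj_ofReal]
        push_cast
        push_cast at this
        linear_combination ((σ : ℂ) * (b x : ℂ) * starRingEnd ℂ (g (-x - Real.pi / 2))) * this
      · intro x
        have h1 : HasDerivAt (fun x : ℝ => -x - Real.pi / 2) (-1) x :=
          (hasDerivAt_neg x).sub_const _
        have h2 := (hg (-x - Real.pi / 2)).scomp x h1
        have h3 := (h2.const_mul ω).star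
        refine HasDerivAt.congr_deriv h3 ?_
        simp
      · exact Complex.continuous_conj.comp (by fun_prop)
      · intro x; rw [Complex.norm_conj, norm_mul, hωn, one_mul]; exact bg _
      · simp only [Complex.norm_conj, norm_mul, hωn, one_mul, norm_neg]; linarith
  · intro x
    simp only [hp x, hap x, Real.cos_add_two_pi]
    congr 1
    have : -(Complex.I * (n : ℂ) * ((x + 2 * Real.pi : ℝ) : ℂ)) =
      -(Complex.I * (n : ℂ) * (x : ℂ)) + ((-n : ℤ) : ℂ) * (2 * Real.pi * Complex.I) := by
      push_cast; ring
    rw [this, Complex.exp_add, Complex.exp_int_mul_two_pi_mul_I, mul_one]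
  · fun_prop

lemma osc_product_nonneg (t A : ℝ) (n : ℤ) (hn : 0 ≤ n) (ht : 1 ≤ t) (hA : 0 < A) (g g' : ℝ → ℂ)
    (hg : ∀ x, HasDerivAt g (g' x) x) (hg' : Continuous g')
    (hp : Function.Periodic g (2 * Real.pi)) (hp' : Function.Periodic g' (2 * Real.pi))
    (bg : ∀ x, ‖g x‖ ≤ A)
    (bg' : ∫ x in (-Real.pi)..Real.pi, ‖g' x‖ ^ 2 ≤ A ^ 2 * t ^ ((1:ℝ)/3)) :
    ‖oscW t n (fun _ => 1) g * oscW t n Real.cos g‖ ≤ 3208 ^ 2 * A ^ 2 * t⁻¹ := by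
  have ht0 : 0 < t := by linarith
  have hc : 0 ≤ (n : ℝ) / (2 * t) := by
    have : (0:ℝ) ≤ n := by exact_mod_cast hn
    positivity
  obtain ⟨r, δ, hr, hδ, h1, h2, h3, h4, h5⟩ := scales t (Real.arccos ((n : ℝ) / (2 * t))) ht
    (Real.arccos_nonneg _)
  have w1 : ‖oscW t n (fun _ => 1) g‖ ≤ 2 * (1604 * A * r) := by
    refine osc_bound t A _ n ht0 _ (fun _ => 1) (fun _ => 1) g g' continuous_const (fun _ => rfl)
      1 (by simp) (fun _ => rfl) (fun _ => by simp) hg hg' hp hp' bg bg' ?_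
    intro G G' hG hG' bG bG'
    have := (main_half t _ r δ A ht hc hA hr hδ h1 h2 h3 h4 h5 G G' hG hG' bG bG').1
    simpa using this
  have w2 : ‖oscW t n Real.cos g‖ ≤ 2 * (1604 * A * r * δ) := by
    refine osc_bound t A _ n ht0 _ Real.cos Real.sin g g' Real.continuous_cos Real.cos_periodic
      (-1) (by simp) Real.cos_sub_pi_div_two (fun x => ?_) hg hg' hp hp' bg bg' ?_
    · rw [← Real.cos_neg, neg_one_mul, ← Real.cos_add_pi_div_two]; congr 1; ring
    intro G G' hG hG' bG bG'
    exact (main_half t _ r δ A ht hc hA hr hδ h1 h2 h3 h4 h5 G G' hG hG' bG bG').2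
  rw [norm_mul]
  refine (mul_le_mul w1 w2 (norm_nonneg _) (by positivity)).trans (le_of_eq ?_)
  have : t⁻¹ = r ^ 2 * δ := by field_simp; linarith
  rw [this]
  ring

lemma osc_product (t A : ℝ) (n : ℤ) (ht : 1 ≤ t) (hA : 0 < A) (g g' : ℝ → ℂ)
    (hg : ∀ x, HasDerivAt g (g' x) x) (hg' : Continuous g')
    (hp : Function.Periodic g (2 * Real.pi)) (hp' : Function.Periodic g' (2 * Real.pi))
    (bg : ∀ x, ‖g x‖ ≤ A)
    (bg' : ∫ x in (-Real.pi)..Real.pi, ‖g' x‖ ^ 2 ≤ A ^ 2 * t ^ ((1:ℝ)/3)) :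
    ‖oscW t n (fun _ => 1) g * oscW t n Real.cos g‖ ≤ 3208 ^ 2 * A ^ 2 * t⁻¹ := by
  rcases le_total 0 n with hn | hn
  · exact osc_product_nonneg t A n hn ht hA g g' hg hg' hp hp' bg bg'
  · rw [osc_reflect t n _ g (fun _ => rfl), osc_reflect t n _ g Real.cos_neg]
    refine osc_product_nonneg t A (-n) (by lia) ht hA _ (fun x => - g' (-x)) ?_ ?_ ?_ ?_ ?_ ?_
    · intro x
      refine HasDerivAt.congr_deriv ((hg (-x)).scomp x (hasDerivAt_neg x)) ?_
      simp
    · fun_prop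
    · intro x
      simp only
      rw [← hp (-(x + 2 * Real.pi))]; congr 1; ring
    · intro x
      simp only
      rw [← hp' (-(x + 2 * Real.pi))]; congr 2; ring
    · intro x; exact bg _
    · simp only [norm_neg]
      have := intervalIntegral.integral_comp_neg (a := -Real.pi) (b := Real.pi)
        (fun x => ‖g' x‖ ^ 2)
      rw [neg_neg] at this
      rwa [this]

lemma int_exp (j : ℤ) : ∫ x in (-Real.pi)..Real.pi, Complex.exp (Complex.I * (j : ℂ) * (x : ℂ)) =
    if j = 0 then ((2 * Real.pi : ℝ) : ℂ) else 0 := by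
  split_ifs with h
  · subst h
    simp
    ring
  · have hj : Complex.I * (j : ℂ) ≠ 0 := by simp [h]
    rw [integral_exp_mul_complex hj]
    have : Complex.I * (j : ℂ) * (Real.pi : ℂ) = Complex.I * (j : ℂ) * ((-Real.pi : ℝ) : ℂ)
      + (j : ℂ) * (2 * Real.pi * Complex.I) := by push_cast; ring
    rw [this, Complex.exp_add, Complex.exp_int_mul_two_pi_mul_I, mul_one, sub_self, zero_div]

lemma parseval (s : Finset ℤ) (a : ℤ → ℂ) :
    ∫ x in (-Real.pi)..Real.pi, ‖∑ k ∈ s, a k * Complex.exp (Complex.I * (k : ℂ) * (x : ℂ))‖ ^ 2 =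
      2 * Real.pi * ∑ k ∈ s, ‖a k‖ ^ 2 := by
  have h : ((∫ x in (-Real.pi)..Real.pi,
      ‖∑ k ∈ s, a k * Complex.exp (Complex.I * (k : ℂ) * (x : ℂ))‖ ^ 2 : ℝ) : ℂ) =
      ((2 * Real.pi * ∑ k ∈ s, ‖a k‖ ^ 2 : ℝ) : ℂ) := by
    rw [← intervalIntegral.integral_ofReal]
    have e : ∀ x : ℝ, ((‖∑ k ∈ s, a k * Complex.exp (Complex.I * (k : ℂ) * (x : ℂ))‖ ^ 2 : ℝ) : ℂ) =
        ∑ j ∈ s, ∑ k ∈ s, (a j * starRingEnd ℂ (a k)) *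
          Complex.exp (Complex.I * ((j - k : ℤ) : ℂ) * (x : ℂ)) := by
      intro x
      push_cast
      rw [← Complex.mul_conj', map_sum, Finset.sum_mul_sum]
      refine Finset.sum_congr rfl fun j _ => Finset.sum_congr rfl fun k _ => ?_
      rw [map_mul, ← Complex.exp_conj]
      simp only [map_mul, Complex.conj_I, Complex.conj_ofReal, map_intCast]
      have : Complex.exp (Complex.I * (j - k) * (x : ℂ)) = Complex.exp (Complex.I * j * (x : ℂ)) *
        Complex.exp (-Complex.I * k * (x : ℂ)) := by
        rw [← Complex.exp_add]; congr 1; ring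
      rw [this]; ring
    simp_rw [e]
    rw [intervalIntegral.integral_finsetSum]
    · have : ∀ j ∈ s, ∫ x in (-Real.pi)..Real.pi, ∑ k ∈ s, (a j * starRingEnd ℂ (a k)) *
          Complex.exp (Complex.I * ((j - k : ℤ) : ℂ) * (x : ℂ)) = (2 * Real.pi) * ‖a j‖ ^ 2 := by
        intro j hj
        rw [intervalIntegral.integral_finsetSum]
        · simp_rw [intervalIntegral.integral_const_mul, int_exp]
          rw [Finset.sum_eq_single j]
          · simp only [sub_self, if_true]
            rw [Complex.mul_conj']
            push_cast
            ring
          · intro k _ hk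
            rw [if_neg, mul_zero]
            intro h; exact hk (by lia)
          · intro h; exact absurd hj h
        · intro k _
          exact (by fun_prop : Continuous _).intervalIntegrable _ _
      rw [Finset.sum_congr rfl this]
      push_cast
      rw [Finset.mul_sum]
    · intro k _
      exact (by fun_prop : Continuous _).intervalIntegrable _ _
  exact_mod_cast h

lemma summable_of_weighted (f : ℤ → ℂ) (h : Summable (fun n : ℤ => (n : ℝ) ^ 2 * ‖f n‖ ^ 2)) :
    Summable (fun n => ‖f n‖) := by
  have h1 : Summable (fun n : ℤ => 1 / ((n : ℝ) ^ 2)) := by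
    have := (Real.summable_one_div_int_pow (p := 2)).2 (by norm_num)
    exact this
  have h2 := h.add h1
  have h3 : Summable (fun n : ℤ => if n = 0 then ‖f 0‖ else 0) :=
    summable_of_hasFiniteSupport ((Set.finite_singleton (0:ℤ)).subset (by
      intro n hn
      simp only [Function.mem_support, ne_eq, ite_eq_right_iff, Classical.not_imp] at hn
      exact hn.1))
  refine Summable.of_nonneg_of_le (fun n => norm_nonneg _) (fun n => ?_) (h2.add h3)
  rcases eq_or_ne n 0 with hn | hn
  · subst hn; simp
  · simp only [hn, if_false, add_zero]
    have hn' : (n : ℝ) ≠ 0 := by exact_mod_cast hn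
    have hp : 0 < (n:ℝ) ^ 2 := by positivity
    have e : (n:ℝ) ^ 2 * ‖f n‖ ^ 2 + 1 / (n:ℝ) ^ 2 - 2 * (1 * ‖f n‖) =
      ((n : ℝ) ^ 2 * ‖f n‖ - 1) ^ 2 / (n : ℝ) ^ 2 := by field_simp; ring
    have e2 : 0 ≤ ((n : ℝ) ^ 2 * ‖f n‖ - 1) ^ 2 / (n : ℝ) ^ 2 := by positivity
    nlinarith [norm_nonneg (f n)]

/-- Partial Fourier sums. -/
noncomputable def partFT (f : ℤ → ℂ) (s : Finset ℤ) (ξ : ℝ) : ℂ :=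
  (Real.sqrt (2 * Real.pi) : ℂ)⁻¹ *
    ∑ n ∈ s, f n * Complex.exp (Complex.I * (n : ℂ) * (ξ : ℂ))

lemma norm_kappa_sq : ‖(Real.sqrt (2 * Real.pi) : ℂ)⁻¹‖ ^ 2 * (2 * Real.pi) = 1 := by
  rw [norm_inv, Complex.norm_real, Real.norm_eq_abs, inv_pow, sq_abs,
    Real.sq_sqrt (by positivity)]
  have := Real.pi_pos
  field_simp

lemma exp_per (k : ℤ) (x : ℝ) : Complex.exp (Complex.I * (k : ℂ) * ((x + 2 * Real.pi : ℝ) : ℂ)) =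
    Complex.exp (Complex.I * (k : ℂ) * (x : ℂ)) := by
  have : Complex.I * (k : ℂ) * ((x + 2 * Real.pi : ℝ) : ℂ) =
      Complex.I * (k : ℂ) * (x : ℂ) + (k : ℂ) * (2 * Real.pi * Complex.I) := by
    push_cast; ring
  rw [this, Complex.exp_add, Complex.exp_int_mul_two_pi_mul_I, mul_one]

lemma partFT_periodic (f : ℤ → ℂ) (s : Finset ℤ) : Function.Periodic (partFT f s) (2 * Real.pi) := by
  intro x
  simp only [partFT, exp_per]

lemma partFT_continuous (f : ℤ → ℂ) (s : Finset ℤ) : Continuous (partFT f s) := by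
  unfold partFT; fun_prop

lemma partFT_deriv (f : ℤ → ℂ) (s : Finset ℤ) (x : ℝ) :
    HasDerivAt (partFT f s) (partFT (fun k => f k * (Complex.I * k)) s x) x := by
  unfold partFT
  refine HasDerivAt.const_mul _ ?_
  refine HasDerivAt.fun_sum fun k _ => ?_
  have h1 : HasDerivAt (fun x : ℝ => Complex.I * (k : ℂ) * (x : ℂ)) (Complex.I * (k : ℂ) * 1) x :=
    (Complex.ofRealCLM.hasDerivAt (x := x)).const_mul (Complex.I * (k : ℂ))
  refine HasDerivAt.congr_deriv ((h1.cexp).const_mul (f k)) ?_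
  ring

lemma partFT_energy (f : ℤ → ℂ) (s : Finset ℤ) :
    ∫ x in (-Real.pi)..Real.pi, ‖partFT (fun k => f k * (Complex.I * k)) s x‖ ^ 2 =
      ∑ k ∈ s, (k : ℝ) ^ 2 * ‖f k‖ ^ 2 := by
  simp only [partFT, norm_mul _ (Finset.sum _ _), mul_pow]
  rw [intervalIntegral.integral_const_mul, parseval, ← mul_assoc, norm_kappa_sq, one_mul]
  refine Finset.sum_congr rfl fun k _ => ?_
  simp only [norm_mul, Complex.norm_I, one_mul, Complex.norm_intCast, mul_pow, sq_abs]
  ring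

lemma partFT_unif (f : ℤ → ℂ) (hf : Summable (fun n => ‖f n‖)) :
    TendstoUniformly (fun s : Finset ℤ => partFT f s) (discFT f) Filter.atTop := by
  have h := tendstoUniformly_tsum (f := fun (n : ℤ) (x : ℝ) =>
    (Real.sqrt (2 * Real.pi) : ℂ)⁻¹ * (f n * Complex.exp (Complex.I * (n : ℂ) * (x : ℂ))))
    (u := fun n => ‖(Real.sqrt (2 * Real.pi) : ℂ)⁻¹‖ * ‖f n‖) (hf.mul_left _) ?_
  · convert h using 1
    · ext s x
      simp only [partFT, Finset.mul_sum]
    · ext x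
      rw [discFT, tsum_mul_left]
  · intro n x
    have : Complex.I * (n : ℂ) * (x : ℂ) = ((n * x : ℝ) : ℂ) * Complex.I := by push_cast; ring
    rw [norm_mul, norm_mul, this, Complex.norm_exp_ofReal_mul_I, mul_one]

lemma osc_tendsto (f : ℤ → ℂ) (hf : Summable (fun n => ‖f n‖)) (t : ℝ) (n : ℤ) (a : ℝ → ℝ)
    (ha : Continuous a) :
    Filter.Tendsto (fun s => oscW t n a (partFT f s)) Filter.atTop
      (nhds (oscW t n a (discFT f))) := by
  have hu := partFT_unif f hf
  have hdc : Continuous (discFT f) := hu.continuous (Filter.Eventually.of_forall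
    (partFT_continuous f)).frequently
  have hB : ∃ B, ∀ x ∈ Set.uIcc (-Real.pi) Real.pi, ‖discFT f x‖ ≤ B :=
    isCompact_uIcc.exists_bound_of_continuousOn hdc.continuousOn
  obtain ⟨B, hB⟩ := hB
  unfold oscW
  apply intervalIntegral.tendsto_integral_filter_of_dominated_convergence
    (bound := fun x => |a x| * (B + 1))
  · refine Filter.Eventually.of_forall fun s => ?_
    have := partFT_continuous f s
    exact (by fun_prop : Continuous _).aestronglyMeasurable
  · have := (Metric.tendstoUniformly_iff.1 hu) 1 one_pos
    filter_upwards [this] with s hs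
    refine Filter.Eventually.of_forall fun x hx => ?_
    have e : -(Complex.I * (n : ℂ) * (x : ℂ)) = ((-(n * x) : ℝ) : ℂ) * Complex.I := by
      push_cast; ring
    rw [e, norm_mul, norm_mul, Complex.norm_exp_ofReal_mul_I, Complex.norm_exp_ofReal_mul_I,
      one_mul, mul_one, norm_mul, Complex.norm_real, Real.norm_eq_abs]
    refine mul_le_mul_of_nonneg_left ?_ (abs_nonneg _)
    have h1 := hB x (Set.uIoc_subset_uIcc hx)
    have h2 := hs x
    rw [dist_comm, dist_eq_norm] at h2
    have h3 := norm_add_le (partFT f s x - discFT f x) (discFT f x)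
    rw [sub_add_cancel] at h3
    linarith
  · exact (by fun_prop : Continuous _).intervalIntegrable _ _
  · refine Filter.Eventually.of_forall fun x _ => ?_
    have := hu.tendsto_at x
    exact ((this.const_mul _).const_mul _).mul_const _

lemma alProp_eq (f : ℤ → ℂ) (t : ℝ) (n : ℤ) : alProp f t n =
    (Real.sqrt (2 * Real.pi) : ℂ)⁻¹ * oscW t n (fun _ => 1) (discFT f) := by
  unfold alProp oscW
  simp only [Complex.ofReal_one, one_mul]

lemma alProp_sum (f : ℤ → ℂ) (hf : Summable (fun n => ‖f n‖)) (t : ℝ) (n : ℤ) :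
    alProp f t (n + 1) + alProp f t (n - 1) =
    (Real.sqrt (2 * Real.pi) : ℂ)⁻¹ * (2 * oscW t n Real.cos (discFT f)) := by
  have hdc : Continuous (discFT f) := (partFT_unif f hf).continuous (Filter.Eventually.of_forall
    (partFT_continuous f)).frequently
  unfold alProp oscW
  rw [← mul_add, ← intervalIntegral.integral_add, ← intervalIntegral.integral_const_mul (2 : ℂ)]
  · congr 1
    refine intervalIntegral.integral_congr fun x _ => ?_
    have e1 : Complex.exp (-(Complex.I * ((n + 1 : ℤ) : ℂ) * (x : ℂ))) =
        Complex.exp (-(Complex.I * (n : ℂ) * (x : ℂ))) * Complex.exp (-(x : ℂ) * Complex.I) := by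
      rw [← Complex.exp_add]; congr 1; push_cast; ring
    have e2 : Complex.exp (-(Complex.I * ((n - 1 : ℤ) : ℂ) * (x : ℂ))) =
        Complex.exp (-(Complex.I * (n : ℂ) * (x : ℂ))) * Complex.exp ((x : ℂ) * Complex.I) := by
      rw [← Complex.exp_add]; congr 1; push_cast; ring
    have e3 := Complex.two_cos (x : ℂ)
    rw [e1, e2, Complex.ofReal_cos]
    linear_combination (-(Complex.exp (((2 * t * Real.cos x : ℝ) : ℂ) * Complex.I) * discFT f x *
      Complex.exp (-(Complex.I * (n : ℂ) * (x : ℂ))))) * e3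
  · exact (by fun_prop : Continuous _).intervalIntegrable _ _
  · exact (by fun_prop : Continuous _).intervalIntegrable _ _

/-- Improved bilinear decay for the linear Ablowitz–Ladik flow:
`|u_n(t) (u_{n+1}(t) + u_{n−1}(t))| ≤ C A² t^{−1}`. -/
theorem alProp_bilinear_decay :
    ∃ C : ℝ, 0 < C ∧ ∀ (t A : ℝ), 1 ≤ t → 0 < A → ∀ f : ℤ → ℂ,
      (∀ ξ : ℝ, ‖discFT f ξ‖ ≤ A) →
      Summable (fun n : ℤ => (n : ℝ) ^ 2 * ‖f n‖ ^ 2) →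
      Real.sqrt (∑' n : ℤ, (n : ℝ) ^ 2 * ‖f n‖ ^ 2) ≤ A * t ^ ((1 : ℝ) / 6) →
      ∀ n : ℤ, ‖alProp f t n * (alProp f t (n + 1) + alProp f t (n - 1))‖ ≤
        C * A ^ 2 * t⁻¹ := by
  refine ⟨2 * ‖(Real.sqrt (2 * Real.pi) : ℂ)⁻¹‖ ^ 2 * 3208 ^ 2 * 4 + 1, by positivity, ?_⟩
  intro t A ht hA f hbd hsum hen n
  have ht0 : 0 < t := by linarith
  have hf := summable_of_weighted f hsum
  have hu := partFT_unif f hf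
  set κ := (Real.sqrt (2 * Real.pi) : ℂ)⁻¹ with hκ
  have hen2 : ∑' n : ℤ, (n : ℝ) ^ 2 * ‖f n‖ ^ 2 ≤ A ^ 2 * t ^ ((1 : ℝ) / 3) := by
    have := (Real.sqrt_le_left (by positivity)).1 hen
    rw [mul_pow, ← Real.rpow_natCast (t ^ ((1:ℝ)/6)), ← Real.rpow_mul ht0.le] at this
    norm_num at this ⊢
    exact this
  have hlim := (osc_tendsto f hf t n (fun _ => 1) continuous_const).mul
    (osc_tendsto f hf t n Real.cos Real.continuous_cos)
  have hW : ‖oscW t n (fun _ => 1) (discFT f) * oscW t n Real.cos (discFT f)‖ ≤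
      3208 ^ 2 * (2 * A) ^ 2 * t⁻¹ := by
    refine le_of_tendsto hlim.norm ?_
    filter_upwards [(Metric.tendstoUniformly_iff.1 hu) A hA] with s hs
    refine osc_product t (2 * A) n ht (by positivity) (partFT f s) _ (partFT_deriv f s)
      (partFT_continuous _ s) (partFT_periodic f s) (partFT_periodic _ s) ?_ ?_
    · intro x
      have h1 := hbd x
      have h2 := hs x
      rw [dist_comm, dist_eq_norm] at h2
      have h3 := norm_add_le (partFT f s x - discFT f x) (discFT f x)
      rw [sub_add_cancel] at h3
      linarith
    · rw [partFT_energy]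
      have h4 := hsum.sum_le_tsum s (fun k _ => by positivity)
      have h5 : 0 ≤ A ^ 2 * t ^ ((1 : ℝ) / 3) := by positivity
      nlinarith
  rw [alProp_eq, alProp_sum f hf]
  have e : ‖κ * oscW t n (fun _ => 1) (discFT f) * (κ * (2 * oscW t n Real.cos (discFT f)))‖ =
      2 * ‖κ‖ ^ 2 * ‖oscW t n (fun _ => 1) (discFT f) * oscW t n Real.cos (discFT f)‖ := by
    simp only [norm_mul, Complex.norm_ofNat]
    ring
  rw [e]
  have h6 := mul_le_mul_of_nonneg_left hW (by positivity : 0 ≤ 2 * ‖κ‖ ^ 2)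
  have h7 : 0 ≤ A ^ 2 * t⁻¹ := by positivity
  nlinarith
end
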